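/- Let L be a C^k (k ≥ 2) Tonelli Lagrangian on T𝕋ⁿ without conjugate points. Fix T > 0 and r ∈ ℤⁿ, and let f : ℝⁿ → ℝ be defined by f(x) = 𝒜_T(x, x+r). If b ∈ ℝⁿ is a point where f attains its maximum, then the unique extremal curve c : ℝ → ℝⁿ with c(0) = b and c(T) = b + r satisfies c(s+T) = c(s) + r for all s ∈ ℝ; in particular its projection to 𝕋ⁿ is a T-periodic extremal curve through the class of b, of homotopy class r. -/

import Mathlib

open MeasureTheory
open scoped NNReal

noncomputable section

abbrev E (n : ℕ) : Type := Fin n → ℝ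

/-- The vector of `ℝⁿ` whose coordinates are the integers `m i`. -/
def intVec {n : ℕ} (m : Fin n → ℤ) : E n := fun i => (m i : ℝ)

/-- A Tonelli Lagrangian on `T𝕋ⁿ`, identified with a `ℤⁿ`-periodic (in `x`) function
on `ℝⁿ × ℝⁿ` which is `Cᵏ`, uniformly superlinear in `v` and with positive definite
fiberwise Hessian. -/
structure IsTonelliLagrangian (n : ℕ) (k : ℕ∞) (L : E n × E n → ℝ) : Prop where
  smooth : ContDiff ℝ k L
  periodic : ∀ (x v : E n) (m : Fin n → ℤ), L (x + intVec m, v) = L (x, v)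
  superlinear : ∀ C : ℝ, ∃ R : ℝ, ∀ (x v : E n), R ≤ ‖v‖ → C * ‖v‖ ≤ L (x, v)
  posdef : ∀ (x v w : E n), w ≠ 0 →
    0 < fderiv ℝ (fun v' => fderiv ℝ (fun v'' => L (x, v'')) v' w) v w

/-- Partial differential of `L` in the fiber (velocity) direction. -/
def partialV (n : ℕ) (L : E n × E n → ℝ) (x v : E n) : E n →L[ℝ] ℝ :=
  fderiv ℝ (fun v' => L (x, v')) v

/-- Partial differential of `L` in the base (position) direction. -/
def partialX (n : ℕ) (L : E n × E n → ℝ) (x v : E n) : E n →L[ℝ] ℝ :=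
  fderiv ℝ (fun x' => L (x', v)) x

/-- A `C²` curve satisfying the Euler–Lagrange equation
`d/dt (∂L/∂v(γ, γ')) = ∂L/∂x(γ, γ')`. -/
def IsExtremal (n : ℕ) (L : E n × E n → ℝ) (γ : ℝ → E n) : Prop :=
  ContDiff ℝ 2 γ ∧
  ∀ t : ℝ, HasDerivAt (fun s => partialV n L (γ s) (deriv γ s))
    (partialX n L (γ t) (deriv γ t)) t

/-- `φ` is the (complete, `C^{k-1}`) Euler–Lagrange flow of `L` on `ℝⁿ × ℝⁿ`:
`φ t (x,v) = (γ t, γ' t)` where `γ` is the extremal curve with `(γ 0, γ' 0) = (x, v)`. -/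
def IsELFlow (n : ℕ) (k : ℕ) (L : E n × E n → ℝ)
    (φ : ℝ → E n × E n → E n × E n) : Prop :=
  ContDiff ℝ ((k - 1 : ℕ) : ℕ∞) (fun p : ℝ × (E n × E n) => φ p.1 p.2) ∧
  (∀ z : E n × E n, φ 0 z = z) ∧
  ∀ x v : E n, IsExtremal n L (fun t => (φ t (x, v)).1) ∧
    ∀ t : ℝ, (φ t (x, v)).2 = deriv (fun s => (φ s (x, v)).1) t

/-- The flow `φ` has no conjugate points: for `t ≠ 0` the image of the vertical
subspace `{0} × ℝⁿ` under `Dφ_t(z)` meets `{0} × ℝⁿ` only in `0`. -/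
def NoConjugatePoints (n : ℕ) (φ : ℝ → E n × E n → E n × E n) : Prop :=
  ∀ (z : E n × E n) (t : ℝ), t ≠ 0 → ∀ w : E n,
    (fderiv ℝ (φ t) z (0, w)).1 = 0 → w = 0

/-- The absolutely continuous curve starting at `x` with derivative `g`. -/
def curveOf (n : ℕ) (x : E n) (g : ℝ → E n) : ℝ → E n :=
  fun s => x + ∫ u in (0:ℝ)..s, g u

/-- `Acost n L t x y` = the infimum of the Lagrangian action over all absolutely
continuous curves `c : [0,t] → ℝⁿ` with `c 0 = x` and `c t = y`. -/
def Acost (n : ℕ) (L : E n × E n → ℝ) (t : ℝ) (x y : E n) : ℝ :=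
  sInf { A : ℝ | ∃ g : ℝ → E n,
    IntervalIntegrable g volume 0 t ∧
    curveOf n x g t = y ∧
    IntervalIntegrable (fun s => L (curveOf n x g s, g s)) volume 0 t ∧
    A = ∫ s in (0:ℝ)..t, L (curveOf n x g s, g s) }

open Set Filter Topology

section Lagrangian

variable {n : ℕ} {L : E n × E n → ℝ}

/-- The momentum `∂L/∂v` at a point of the tangent bundle. -/
def momentum (L : E n × E n → ℝ) (z : E n × E n) : E n →L[ℝ] ℝ :=
  (fderiv ℝ L z).comp (ContinuousLinearMap.inr ℝ (E n) (E n))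

/-- The force `∂L/∂x` at a point of the tangent bundle. -/
def force (L : E n × E n → ℝ) (z : E n × E n) : E n →L[ℝ] ℝ :=
  (fderiv ℝ L z).comp (ContinuousLinearMap.inl ℝ (E n) (E n))

/-- The energy `∂L/∂v · v - L`. -/
def energy (L : E n × E n → ℝ) (z : E n × E n) : ℝ := momentum L z z.2 - L z

lemma fderiv_eq_force_add_momentum (L : E n × E n → ℝ) (z w : E n × E n) :
    fderiv ℝ L z w = force L z w.1 + momentum L z w.2 := by
  simp [force, momentum, ← map_add]

lemma hasFDerivAt_of_contDiff_two (hL : ContDiff ℝ 2 L) (z : E n × E n) :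
    HasFDerivAt L (fderiv ℝ L z) z :=
  (hL.differentiable (by norm_num) z).hasFDerivAt

lemma hasFDerivAt_velocity (hL : ContDiff ℝ 2 L) (x v : E n) :
    HasFDerivAt (fun v' => L (x, v')) (momentum L (x, v)) v :=
  (hasFDerivAt_of_contDiff_two hL (x, v)).comp v (hasFDerivAt_prodMk_right x v)

lemma hasFDerivAt_position (hL : ContDiff ℝ 2 L) (x v : E n) :
    HasFDerivAt (fun x' => L (x', v)) (force L (x, v)) x :=
  (hasFDerivAt_of_contDiff_two hL (x, v)).comp x (hasFDerivAt_prodMk_left x v)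

lemma partialV_eq (hL : ContDiff ℝ 2 L) (x v : E n) : partialV n L x v = momentum L (x, v) :=
  (hasFDerivAt_velocity hL x v).fderiv

lemma partialX_eq (hL : ContDiff ℝ 2 L) (x v : E n) : partialX n L x v = force L (x, v) :=
  (hasFDerivAt_position hL x v).fderiv

lemma contDiff_momentum (hL : ContDiff ℝ 2 L) : ContDiff ℝ 1 (momentum L) :=
  (hL.fderiv_right (m := 1) (by norm_num)).clm_comp contDiff_const

lemma contDiff_force (hL : ContDiff ℝ 2 L) : ContDiff ℝ 1 (force L) :=
  (hL.fderiv_right (m := 1) (by norm_num)).clm_comp contDiff_const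

lemma continuous_energy (hL : ContDiff ℝ 2 L) : Continuous (energy L) :=
  ((contDiff_momentum hL).continuous.clm_apply continuous_snd).sub hL.continuous

/-- Fiberwise convexity: the fiberwise Hessian of `L` is positive definite. -/
def FiberConvex (L : E n × E n → ℝ) : Prop :=
  ∀ (z : E n × E n) (w : E n), w ≠ 0 → 0 < fderiv ℝ (momentum L) z (0, w) w

lemma hasDerivAt_momentum_line (hL : ContDiff ℝ 2 L) (x v w : E n) (t : ℝ) :
    HasDerivAt (fun τ : ℝ => momentum L (x, v + τ • w) w)
      (fderiv ℝ (momentum L) (x, v + t • w) (0, w) w) t := by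
  have h1 : HasDerivAt (fun τ : ℝ => (x, v + τ • w)) ((0 : E n), w) t := by
    refine (hasDerivAt_const t x).prodMk ?_
    simpa using ((hasDerivAt_id t).smul_const w).const_add v
  have h2 := ((contDiff_momentum hL).differentiable (by norm_num)
    (x, v + t • w)).hasFDerivAt.comp_hasDerivAt t h1
  simpa using h2.clm_apply (hasDerivAt_const t w)

lemma IsTonelliLagrangian.contDiff_two {k : ℕ} (hk : 2 ≤ k)
    (hL : IsTonelliLagrangian n (k : ℕ∞) L) : ContDiff ℝ 2 L :=
  hL.smooth.of_le (by
    have h : ((2 : ℕ) : ℕ∞) ≤ (k : ℕ∞) := by exact_mod_cast hk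
    exact WithTop.coe_le_coe.2 h)

lemma IsTonelliLagrangian.fiberConvex {k : ℕ} (hk : 2 ≤ k)
    (hL : IsTonelliLagrangian n (k : ℕ∞) L) : FiberConvex L := by
  intro z w hw
  have h2 := hL.contDiff_two hk
  have h := hL.posdef z.1 z.2 w hw
  have e : (fun v' => fderiv ℝ (fun v'' => L (z.1, v'')) v' w)
      = fun v' => momentum L (z.1, v') w := by
    funext v'
    rw [(hasFDerivAt_velocity h2 z.1 v').fderiv]
  rw [e] at h
  have h3 : HasFDerivAt (fun v' => momentum L (z.1, v'))
      ((fderiv ℝ (momentum L) z).comp (ContinuousLinearMap.inr ℝ (E n) (E n))) z.2 :=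
    ((contDiff_momentum h2).differentiable (by norm_num) (z.1, z.2)).hasFDerivAt.comp z.2
      (hasFDerivAt_prodMk_right z.1 z.2)
  have h4 := h3.clm_apply (hasFDerivAt_const w z.2)
  rw [h4.fderiv] at h
  simpa using h

lemma momentum_line_strictMono (hL : ContDiff ℝ 2 L) (hc : FiberConvex L) (x v w : E n)
    (hw : w ≠ 0) : StrictMono (fun τ : ℝ => momentum L (x, v + τ • w) w) := by
  refine strictMono_of_deriv_pos fun t => ?_
  rw [(hasDerivAt_momentum_line hL x v w t).deriv]
  exact hc _ w hw

lemma momentum_injective (hL : ContDiff ℝ 2 L) (hc : FiberConvex L) {x v w : E n}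
    (h : momentum L (x, v) = momentum L (x, w)) : v = w := by
  by_contra hne
  have := momentum_line_strictMono hL hc x v (w - v) (sub_ne_zero.2 (Ne.symm hne)) zero_lt_one
  simp [h] at this

/-- The Weierstrass excess function is nonnegative. -/
lemma weierstrass_excess (hL : ContDiff ℝ 2 L) (hc : FiberConvex L) (x v w : E n) :
    L (x, v) + momentum L (x, v) (w - v) ≤ L (x, w) := by
  rcases eq_or_ne (w - v) 0 with h0 | hne
  · obtain rfl : w = v := sub_eq_zero.1 h0
    simp
  have hd : ∀ t : ℝ, HasDerivAt (fun τ : ℝ => L (x, v + τ • (w - v)))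
      (momentum L (x, v + t • (w - v)) (w - v)) t := by
    intro t
    refine HasFDerivAt.comp_hasDerivAt (l := fun v' => L (x, v')) t
      (hasFDerivAt_velocity hL x (v + t • (w - v))) ?_
    simpa using ((hasDerivAt_id t).smul_const (w - v)).const_add v
  obtain ⟨t, ht, h⟩ := exists_hasDerivAt_eq_slope (fun τ : ℝ => L (x, v + τ • (w - v))) _
    zero_lt_one (fun t _ => (hd t).continuousAt.continuousWithinAt) fun t _ => hd t
  have hm := momentum_line_strictMono hL hc x v (w - v) hne ht.1
  simp only [zero_smul, add_zero, h, one_smul, add_sub_cancel, sub_zero, div_one] at hm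
  linarith

lemma continuous_periodic_bounded {F : E n × E n → ℝ} (hF : Continuous F)
    (hper : ∀ (x v : E n) (m : Fin n → ℤ), F (x + intVec m, v) = F (x, v)) (B : ℝ) :
    ∃ M : ℝ, ∀ x v : E n, ‖v‖ ≤ B → |F (x, v)| ≤ M := by
  obtain ⟨M, hM⟩ := ((isCompact_closedBall (0 : E n) 1).prod
    (isCompact_closedBall (0 : E n) B)).exists_bound_of_continuousOn hF.continuousOn
  refine ⟨M, fun x v hv => ?_⟩
  have hx : x = (fun i => Int.fract (x i)) + intVec (fun i => ⌊x i⌋) := by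
    funext i
    simp [intVec, Int.fract_add_floor]
  rw [hx, hper]
  refine hM (_, v) ⟨?_, by simpa using hv⟩
  rw [mem_closedBall_zero_iff, pi_norm_le_iff_of_nonneg zero_le_one]
  intro i
  rw [Real.norm_eq_abs, abs_of_nonneg (Int.fract_nonneg _)]
  exact (Int.fract_lt_one _).le

lemma IsTonelliLagrangian.fderiv_periodic {k : ℕ∞} (hL : IsTonelliLagrangian n k L)
    (x v : E n) (m : Fin n → ℤ) : fderiv ℝ L (x + intVec m, v) = fderiv ℝ L (x, v) := by
  have h : (fun z : E n × E n => L (z + (intVec m, 0))) = L := by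
    funext z
    have hz : z + (intVec m, 0) = (z.1 + intVec m, z.2) := by ext <;> simp
    rw [hz, hL.periodic]
  have h2 := fderiv_comp_add_right (𝕜 := ℝ) (f := L) (x := (x, v)) ((intVec m, 0) : E n × E n)
  rw [h] at h2
  simpa using h2.symm

lemma IsTonelliLagrangian.momentum_periodic {k : ℕ∞} (hL : IsTonelliLagrangian n k L)
    (x v : E n) (m : Fin n → ℤ) : momentum L (x + intVec m, v) = momentum L (x, v) := by
  simp [momentum, hL.fderiv_periodic]

lemma IsTonelliLagrangian.force_periodic {k : ℕ∞} (hL : IsTonelliLagrangian n k L)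
    (x v : E n) (m : Fin n → ℤ) : force L (x + intVec m, v) = force L (x, v) := by
  simp [force, hL.fderiv_periodic]

lemma IsTonelliLagrangian.bddBelow {k : ℕ} (hk : 2 ≤ k)
    (hL : IsTonelliLagrangian n (k : ℕ∞) L) : ∃ M : ℝ, ∀ z, -M ≤ L z := by
  obtain ⟨R, hR⟩ := hL.superlinear 0
  obtain ⟨M, hM⟩ := continuous_periodic_bounded (hL.contDiff_two hk).continuous hL.periodic R
  refine ⟨max M 0, fun z => ?_⟩
  rcases le_total R ‖z.2‖ with h | h
  · have := hR z.1 z.2 h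
    have := le_max_right M 0
    simp only [zero_mul] at *
    linarith
  · have := (abs_le.1 (hM z.1 z.2 h)).1
    have := le_max_left M 0
    linarith

/-- The energy is coercive in the velocity, uniformly in the position. -/
lemma IsTonelliLagrangian.energy_coercive {k : ℕ} (hk : 2 ≤ k)
    (hL : IsTonelliLagrangian n (k : ℕ∞) L) (e : ℝ) :
    ∃ R : ℝ, ∀ x v : E n, energy L (x, v) ≤ e → ‖v‖ ≤ R := by
  have h2 := hL.contDiff_two hk
  obtain ⟨M, hM⟩ := continuous_periodic_bounded h2.continuous hL.periodic 1
  obtain ⟨R, hR⟩ := hL.superlinear (|e| + |M| + 1)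
  refine ⟨max R 2, fun x v he => ?_⟩
  by_contra! hv
  have hR' : R ≤ ‖v‖ := (le_max_left _ _).trans hv.le
  have hv2 : 2 < ‖v‖ := (le_max_right _ _).trans_lt hv
  have hsup := hR x v hR'
  set τ := ‖v‖ with hτ
  have hu : ‖τ⁻¹ • v‖ = 1 := by
    rw [norm_smul, norm_inv, Real.norm_of_nonneg (by linarith), ← hτ]
    field_simp
  have hM1 := (abs_le.1 (hM x (τ⁻¹ • v) hu.le)).2
  have hw := weierstrass_excess h2 (hL.fiberConvex hk) x v (τ⁻¹ • v)
  have hp : momentum L (x, v) (τ⁻¹ • v - v) = (τ⁻¹ - 1) * momentum L (x, v) v := by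
    simp [sub_mul]
  rw [hp] at hw
  set P := momentum L (x, v) v with hP
  have he' : P - L (x, v) ≤ e := he
  have h3 : τ * L (x, v) + (1 - τ) * P ≤ τ * M := by
    have : τ * (L (x, v) + (τ⁻¹ - 1) * P) ≤ τ * M :=
      mul_le_mul_of_nonneg_left (by linarith) (by linarith)
    have e2 : τ * (L (x, v) + (τ⁻¹ - 1) * P) = τ * L (x, v) + (1 - τ) * P := by
      have : τ ≠ 0 := by linarith
      field_simp
    linarith
  have h4 : (1 - τ) * (e + L (x, v)) ≤ (1 - τ) * P :=
    mul_le_mul_of_nonpos_left (by linarith) (by linarith)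
  have h5 : τ * e ≤ τ * |e| := mul_le_mul_of_nonneg_left (le_abs_self e) (by linarith)
  have h6 : τ * M ≤ τ * |M| := mul_le_mul_of_nonneg_left (le_abs_self M) (by linarith)
  have h7 : -|e| ≤ e := neg_abs_le e
  nlinarith [abs_nonneg e, abs_nonneg M]

end Lagrangian

section Extremals

variable {n : ℕ} {L : E n × E n → ℝ} {γ η : ℝ → E n}

lemma IsExtremal.hasDerivAt (h : IsExtremal n L γ) (t : ℝ) : HasDerivAt γ (deriv γ t) t :=
  (h.1.differentiable (by norm_num) t).hasDerivAt

lemma IsExtremal.contDiff_deriv (h : IsExtremal n L γ) : ContDiff ℝ 1 (deriv γ) := by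
  have h2 : ContDiff ℝ (1 + 1) γ := by rw [one_add_one_eq_two]; exact h.1
  exact (contDiff_succ_iff_deriv.1 h2).2.2

lemma IsExtremal.continuous (h : IsExtremal n L γ) : Continuous γ := h.1.continuous

lemma IsExtremal.continuous_deriv (h : IsExtremal n L γ) : Continuous (deriv γ) :=
  h.contDiff_deriv.continuous

lemma IsExtremal.hasDerivAt_momentum (hL : ContDiff ℝ 2 L) (h : IsExtremal n L γ) (t : ℝ) :
    HasDerivAt (fun s => momentum L (γ s, deriv γ s)) (force L (γ t, deriv γ t)) t := by
  simpa only [partialV_eq hL, partialX_eq hL] using h.2 t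

lemma isExtremal_iff (hL : ContDiff ℝ 2 L) : IsExtremal n L γ ↔ ContDiff ℝ 2 γ ∧
    ∀ t, HasDerivAt (fun s => momentum L (γ s, deriv γ s)) (force L (γ t, deriv γ t)) t := by
  simp only [IsExtremal, partialV_eq hL, partialX_eq hL]

lemma IsExtremal.shift (hL : ContDiff ℝ 2 L) (h : IsExtremal n L γ) (a : ℝ) :
    IsExtremal n L (fun t => γ (t + a)) := by
  refine (isExtremal_iff hL).2 ⟨h.1.comp (contDiff_id.add contDiff_const), fun t => ?_⟩
  have hd : deriv (fun t => γ (t + a)) = fun t => deriv γ (t + a) := by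
    funext s; exact deriv_comp_add_const γ a s
  rw [hd]
  exact (h.hasDerivAt_momentum hL (t + a)).comp_add_const t a

lemma IsExtremal.sub_intVec {k : ℕ} (hk : 2 ≤ k) (hT : IsTonelliLagrangian n (k : ℕ∞) L)
    (h : IsExtremal n L γ) (r : Fin n → ℤ) : IsExtremal n L (fun t => γ t - intVec r) := by
  have hL := hT.contDiff_two hk
  refine (isExtremal_iff hL).2 ⟨h.1.sub contDiff_const, fun t => ?_⟩
  have hd : deriv (fun t => γ t - intVec r) = deriv γ := by
    funext s; exact deriv_sub_const _
  have hm : ∀ y v, momentum L (y - intVec r, v) = momentum L (y, v) := fun y v => by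
    rw [← hT.momentum_periodic (y - intVec r) v r, sub_add_cancel]
  have hf : ∀ y v, force L (y - intVec r, v) = force L (y, v) := fun y v => by
    rw [← hT.force_periodic (y - intVec r) v r, sub_add_cancel]
  simpa only [hd, hm, hf] using h.hasDerivAt_momentum hL t

/-- Conservation of energy. -/
lemma IsExtremal.energy_eq (hL : ContDiff ℝ 2 L) (h : IsExtremal n L γ) (s t : ℝ) :
    energy L (γ s, deriv γ s) = energy L (γ t, deriv γ t) := by
  have hd : ∀ s, HasDerivAt (fun s => energy L (γ s, deriv γ s)) 0 s := by
    intro s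
    have hv := (h.contDiff_deriv.differentiable (by norm_num) s).hasDerivAt
    have h1 := (h.hasDerivAt_momentum hL s).clm_apply hv
    have h2 := (hasFDerivAt_of_contDiff_two hL (γ s, deriv γ s)).comp_hasDerivAt s
      ((h.hasDerivAt s).prodMk hv)
    rw [fderiv_eq_force_add_momentum] at h2
    refine HasDerivAt.congr_deriv (h1.sub h2) ?_
    simp
  exact is_const_of_deriv_eq_zero (fun s => (hd s).differentiableAt) (fun s => (hd s).deriv) s t

lemma injective_legendre_derivative (hc : FiberConvex L)
    (z : E n × E n) : Function.Injective
      ((ContinuousLinearMap.fst ℝ (E n) (E n)).prod (fderiv ℝ (momentum L) z)) := by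
  rw [injective_iff_map_eq_zero]
  rintro ⟨ξ, ω⟩ h
  simp only [ContinuousLinearMap.prod_apply, ContinuousLinearMap.coe_fst', Prod.mk_eq_zero] at h
  obtain ⟨rfl, h⟩ := h
  by_contra hne
  have hω : ω ≠ 0 := by rintro rfl; exact hne rfl
  have := hc z ω hω
  rw [h] at this
  simp at this

/-- Two extremals with the same position and velocity at a time agree near that time. -/
lemma IsExtremal.eventuallyEq (hL : ContDiff ℝ 2 L) (hc : FiberConvex L)
    (h : IsExtremal n L γ) (h' : IsExtremal n L η) {t : ℝ} (h0 : γ t = η t)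
    (h1 : deriv γ t = deriv η t) :
    (fun s => (γ s, deriv γ s)) =ᶠ[𝓝 t] fun s => (η s, deriv η s) := by
  set z : E n × E n := (γ t, deriv γ t) with hz
  set Λ : E n × E n → E n × (E n →L[ℝ] ℝ) := fun z => (z.1, momentum L z) with hΛ
  have hΛc : ContDiff ℝ 1 Λ := contDiff_fst.prodMk (contDiff_momentum hL)
  have hΛd : HasFDerivAt Λ
      ((ContinuousLinearMap.fst ℝ (E n) (E n)).prod (fderiv ℝ (momentum L) z)) z :=
    hasFDerivAt_fst.prodMk ((contDiff_momentum hL).differentiable (by norm_num) z).hasFDerivAt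
  have hfin : Module.finrank ℝ (E n × E n) = Module.finrank ℝ (E n × (E n →L[ℝ] ℝ)) := by
    rw [Module.finrank_prod, Module.finrank_prod,
      ← (LinearMap.toContinuousLinearMap (𝕜 := ℝ) (E := E n) (F' := ℝ)).finrank_eq,
      Subspace.dual_finrank_eq]
  let A : (E n × E n) ≃L[ℝ] (E n × (E n →L[ℝ] ℝ)) :=
    (LinearEquiv.ofInjectiveOfFinrankEq _ (injective_legendre_derivative hc z)
      hfin).toContinuousLinearEquiv
  have hA : HasFDerivAt Λ (A : (E n × E n) →L[ℝ] (E n × (E n →L[ℝ] ℝ))) z := by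
    convert hΛd using 1
    exact ContinuousLinearMap.ext fun w => rfl
  set e := hΛc.contDiffAt.toOpenPartialHomeomorph Λ hA (by norm_num) with he
  have hzs : z ∈ e.source := hΛc.contDiffAt.mem_toOpenPartialHomeomorph_source hA (by norm_num)
  have hes : ContDiffAt ℝ 1 e.symm (Λ z) :=
    hΛc.contDiffAt.to_localInverse hA (by norm_num)
  set X : E n × (E n →L[ℝ] ℝ) → E n × (E n →L[ℝ] ℝ) :=
    fun q => ((e.symm q).2, force L (e.symm q)) with hX
  have hXc : ContDiffAt ℝ 1 X (Λ z) :=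
    (contDiffAt_snd.comp _ hes).prodMk ((contDiff_force hL).contDiffAt.comp _ hes)
  obtain ⟨K, s, hs, hK⟩ := hXc.exists_lipschitzOnWith
  have key : ∀ {ζ : ℝ → E n}, IsExtremal n L ζ → (ζ t, deriv ζ t) = z →
      (∀ᶠ τ in 𝓝 t, (ζ τ, deriv ζ τ) ∈ e.source) ∧
      ∀ᶠ τ in 𝓝 t, HasDerivAt (fun τ => Λ (ζ τ, deriv ζ τ)) (X (Λ (ζ τ, deriv ζ τ))) τ ∧
        Λ (ζ τ, deriv ζ τ) ∈ s := by
    intro ζ hζ hζz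
    have hcont : Continuous fun τ => (ζ τ, deriv ζ τ) := hζ.continuous.prodMk hζ.continuous_deriv
    have hsrc : ∀ᶠ τ in 𝓝 t, (ζ τ, deriv ζ τ) ∈ e.source :=
      hcont.continuousAt.eventually (by
        change e.source ∈ 𝓝 (ζ t, deriv ζ t)
        rw [hζz]
        exact e.open_source.mem_nhds hzs)
    have hmem : ∀ᶠ τ in 𝓝 t, Λ (ζ τ, deriv ζ τ) ∈ s :=
      (hΛc.continuous.comp hcont).continuousAt.eventually
        (by
          change s ∈ 𝓝 (Λ (ζ t, deriv ζ t))
          rwa [hζz])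
    refine ⟨hsrc, ?_⟩
    filter_upwards [hsrc, hmem] with τ h1 h2
    refine ⟨?_, h2⟩
    have : e.symm (Λ (ζ τ, deriv ζ τ)) = (ζ τ, deriv ζ τ) := e.left_inv h1
    simp only [hX, this]
    exact (hζ.hasDerivAt τ).prodMk (hζ.hasDerivAt_momentum hL τ)
  obtain ⟨k1, k2⟩ := key h rfl
  obtain ⟨k3, k4⟩ := key h' (by rw [hz, h0, h1])
  have heq := ODE_solution_unique_of_eventually (v := fun _ => X) (s := fun _ => s)
    (Eventually.of_forall fun _ => hK) k2 k4 (by simp only [h0, h1])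
  filter_upwards [heq, k1, k3] with τ h1 h2 h3
  exact e.injOn h2 h3 h1

/-- Extremals are determined by their position and velocity at one time. -/
theorem IsExtremal.unique (hL : ContDiff ℝ 2 L) (hc : FiberConvex L)
    (h : IsExtremal n L γ) (h' : IsExtremal n L η) {t : ℝ} (h0 : γ t = η t)
    (h1 : deriv γ t = deriv η t) : γ = η := by
  have hu : {s | (γ s, deriv γ s) = (η s, deriv η s)} = univ := by
    refine IsClopen.eq_univ ⟨isClosed_eq (h.continuous.prodMk h.continuous_deriv)
      (h'.continuous.prodMk h'.continuous_deriv), ?_⟩ ⟨t, by simp [h0, h1]⟩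
    rw [isOpen_iff_mem_nhds]
    intro s hs
    exact h.eventuallyEq hL hc h' (Prod.ext_iff.1 hs).1 (Prod.ext_iff.1 hs).2
  funext s
  have : s ∈ {s | (γ s, deriv γ s) = (η s, deriv η s)} := hu ▸ mem_univ s
  exact (Prod.ext_iff.1 this).1

end Extremals

section ParametricIntegral

variable {H F : Type*} [NormedAddCommGroup F] [NormedSpace ℝ F]

/-- The primitive in the first variable. -/
def primitive (G : ℝ × H → F) (p : ℝ × H) : F := ∫ σ in (0 : ℝ)..p.1, G (σ, p.2)

lemma primitive_eq_smul (G : ℝ × H → F) (p : ℝ × H) :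
    primitive G p = p.1 • ∫ θ in (0 : ℝ)..1, G (p.1 * θ, p.2) := by
  rw [intervalIntegral.smul_integral_comp_mul_left (fun σ => G (σ, p.2))]
  simp [primitive]

lemma hasDerivAt_primitive [TopologicalSpace H] [CompleteSpace F] {G : ℝ × H → F}
    (hG : Continuous G) (s : ℝ) (v : H) :
    HasDerivAt (fun σ => primitive G (σ, v)) (G (s, v)) s := by
  have hc : Continuous fun σ : ℝ => G (σ, v) := hG.comp (by fun_prop)
  exact intervalIntegral.integral_hasDerivAt_right (hc.intervalIntegrable _ _)
    hc.aestronglyMeasurable.stronglyMeasurableAtFilter hc.continuousAt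

variable [NormedAddCommGroup H] [NormedSpace ℝ H] [FiniteDimensional ℝ H]

lemma hasFDerivAt_parametric_integral {f : H × ℝ → F} (hf : ContDiff ℝ 1 f) (a b : ℝ) (x₀ : H) :
    HasFDerivAt (fun x => ∫ t in a..b, f (x, t))
      (∫ t in a..b, (fderiv ℝ f (x₀, t)).comp (ContinuousLinearMap.inl ℝ H ℝ)) x₀ := by
  have : ProperSpace H := FiniteDimensional.proper ℝ H
  have hd : Continuous fun p => (fderiv ℝ f p).comp (ContinuousLinearMap.inl ℝ H ℝ) :=
    (hf.continuous_fderiv (by norm_num)).clm_comp continuous_const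
  obtain ⟨C, hC⟩ := ((isCompact_closedBall x₀ 1).prod
    (isCompact_uIcc (a := a) (b := b))).exists_bound_of_continuousOn hd.continuousOn
  refine intervalIntegral.hasFDerivAt_integral_of_dominated_of_fderiv_le
    (F := fun x t => f (x, t)) (bound := fun _ => C)
    (F' := fun x t => (fderiv ℝ f (x, t)).comp (ContinuousLinearMap.inl ℝ H ℝ))
    (Metric.closedBall_mem_nhds x₀ one_pos)
    (Eventually.of_forall fun x => ?_) ?_ ?_ ?_ ?_ ?_
  · exact (hf.continuous.comp (by fun_prop)).aestronglyMeasurable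
  · exact (hf.continuous.comp (by fun_prop)).intervalIntegrable _ _
  · exact (hd.comp (by fun_prop)).aestronglyMeasurable
  · exact Eventually.of_forall fun t ht x hx => hC (x, t) ⟨hx, uIoc_subset_uIcc ht⟩
  · exact intervalIntegrable_const
  · refine Eventually.of_forall fun t _ x _ => ?_
    exact (hf.differentiable (by norm_num) (x, t)).hasFDerivAt.comp x (hasFDerivAt_prodMk_left x t)

lemma contDiff_parametric_integral {f : H × ℝ → F} (hf : ContDiff ℝ 1 f) (a b : ℝ) :
    ContDiff ℝ 1 fun x => ∫ t in a..b, f (x, t) := by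
  refine contDiff_one_iff_fderiv.2
    ⟨fun x => (hasFDerivAt_parametric_integral hf a b x).differentiableAt, ?_⟩
  have : fderiv ℝ (fun x => ∫ t in a..b, f (x, t)) = fun x => ∫ t in a..b,
      (fderiv ℝ f (x, t)).comp (ContinuousLinearMap.inl ℝ H ℝ) :=
    funext fun x => (hasFDerivAt_parametric_integral hf a b x).fderiv
  rw [this]
  refine intervalIntegral.continuous_parametric_intervalIntegral_of_continuous' ?_ a b
  exact (hf.continuous_fderiv (by norm_num)).clm_comp continuous_const

lemma contDiff_primitive {G : ℝ × H → F} (hG : ContDiff ℝ 1 G) : ContDiff ℝ 1 (primitive G) := by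
  rw [funext (primitive_eq_smul G)]
  refine contDiff_fst.smul (contDiff_parametric_integral
    (f := fun q : (ℝ × H) × ℝ => G (q.1.1 * q.2, q.1.2)) ?_ 0 1)
  exact hG.comp (by fun_prop)

lemma fderiv_primitive_fst [CompleteSpace F] {G : ℝ × H → F} (hG : ContDiff ℝ 1 G) (s : ℝ) (v : H)
    (τ : ℝ) :
    fderiv ℝ (primitive G) (s, v) (τ, 0) = τ • G (s, v) := by
  have h1 := ((contDiff_primitive hG).differentiable
    (by norm_num) (s, v)).hasFDerivAt.comp_hasDerivAt s
      ((hasDerivAt_id s).prodMk (hasDerivAt_const s v))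
  have h2 := h1.unique (hasDerivAt_primitive hG.continuous s v)
  rw [← h2, ← map_smul]
  simp

lemma fderiv_primitive_snd [CompleteSpace F] {G : ℝ × H → F} (hG : ContDiff ℝ 1 G) (s : ℝ)
    (v ω : H) :
    fderiv ℝ (primitive G) (s, v) (0, ω) = ∫ σ in (0 : ℝ)..s, fderiv ℝ G (σ, v) (0, ω) := by
  have h1 := ((contDiff_primitive hG).differentiable (by norm_num) (s, v)).hasFDerivAt.comp v
    (hasFDerivAt_prodMk_right s v)
  have hsw : ContDiff ℝ 1 fun q : H × ℝ => G q.swap := hG.comp (contDiff_snd.prodMk contDiff_fst)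
  have h2 := hasFDerivAt_parametric_integral hsw 0 s v
  have h3 := congrArg (fun A : H →L[ℝ] F => A ω) (h1.unique h2)
  simp only [ContinuousLinearMap.comp_apply, ContinuousLinearMap.inr_apply] at h3
  rw [h3, ContinuousLinearMap.intervalIntegral_apply]
  · refine intervalIntegral.integral_congr fun σ _ => ?_
    have h4 : HasFDerivAt (fun q : H × ℝ => G q.swap) ((fderiv ℝ G (σ, v)).comp
        ((ContinuousLinearMap.snd ℝ H ℝ).prod (ContinuousLinearMap.fst ℝ H ℝ))) (v, σ) :=
      (hG.differentiable (by norm_num) (σ, v)).hasFDerivAt.comp (v, σ)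
        (hasFDerivAt_snd.prodMk hasFDerivAt_fst)
    simp [h4.fderiv]
  · refine Continuous.intervalIntegrable ?_ _ _
    exact ((hsw.continuous_fderiv (by norm_num)).comp (by fun_prop)).clm_comp continuous_const

end ParametricIntegral

section CentralField

variable {n : ℕ} {L : E n × E n → ℝ} {x : E n} {X Y : ℝ × E n → E n}

/-- `X (s, v)` is the position and `Y (s, v)` the velocity at time `s` of the extremal leaving `x`
with velocity `v`, and no point is conjugate to `x`. -/
structure CentralField (L : E n × E n → ℝ) (x : E n) (X Y : ℝ × E n → E n) : Prop where
  contDiff_position : ContDiff ℝ 1 X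
  contDiff_velocity : ContDiff ℝ 1 Y
  position_zero : ∀ v, X (0, v) = x
  velocity_zero : ∀ v, Y (0, v) = v
  isExtremal : ∀ v, IsExtremal n L fun s => X (s, v)
  deriv_position : ∀ s v, deriv (fun σ => X (σ, v)) s = Y (s, v)
  nondegenerate : ∀ s v ω, s ≠ 0 → fderiv ℝ X (s, v) (0, ω) = 0 → ω = 0

/-- The action up to time `s` of the extremal of the field with initial velocity `v`. -/
def fieldAction (L : E n × E n → ℝ) (X Y : ℝ × E n → E n) : ℝ × E n → ℝ :=
  primitive fun p => L (X p, Y p)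

namespace CentralField

lemma hasDerivAt_position (h : CentralField L x X Y) (s : ℝ) (v : E n) :
    HasDerivAt (fun σ => X (σ, v)) (Y (s, v)) s :=
  h.deriv_position s v ▸ (h.isExtremal v).hasDerivAt s

lemma deriv_eq (h : CentralField L x X Y) (v : E n) :
    deriv (fun σ => X (σ, v)) = fun s => Y (s, v) := funext fun s => h.deriv_position s v

lemma position_eq (h : CentralField L x X Y) (p : ℝ × E n) : X p = x + primitive Y p := by
  obtain ⟨s, v⟩ := p
  have hc : Continuous fun σ : ℝ => Y (σ, v) := h.contDiff_velocity.continuous.comp (by fun_prop)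
  have := intervalIntegral.integral_eq_sub_of_hasDerivAt
    (fun σ _ => h.hasDerivAt_position σ v) (hc.intervalIntegrable 0 s)
  rw [primitive, this, h.position_zero]
  abel

lemma fderiv_position_time (h : CentralField L x X Y) (s : ℝ) (v : E n) (τ : ℝ) :
    fderiv ℝ X (s, v) (τ, 0) = τ • Y (s, v) := by
  rw [funext h.position_eq, fderiv_const_add, fderiv_primitive_fst h.contDiff_velocity]

lemma contDiff_lagrangian (hL : ContDiff ℝ 2 L) (h : CentralField L x X Y) :
    ContDiff ℝ 1 fun p => L (X p, Y p) :=
  (hL.of_le (by norm_num)).comp (h.contDiff_position.prodMk h.contDiff_velocity)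

lemma contDiff_fieldAction (hL : ContDiff ℝ 2 L) (h : CentralField L x X Y) :
    ContDiff ℝ 1 (fieldAction L X Y) := contDiff_primitive (h.contDiff_lagrangian hL)

lemma hasDerivAt_jacobi (h : CentralField L x X Y) (s : ℝ) (v ω : E n) :
    HasDerivAt (fun σ => fderiv ℝ X (σ, v) (0, ω)) (fderiv ℝ Y (s, v) (0, ω)) s := by
  have : (fun σ => fderiv ℝ X (σ, v) (0, ω)) =
      fun σ => primitive (fun p => fderiv ℝ Y p (0, ω)) (σ, v) := by
    funext σ
    rw [funext h.position_eq, fderiv_const_add, fderiv_primitive_snd h.contDiff_velocity]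
    rfl
  rw [this]
  exact hasDerivAt_primitive
    ((h.contDiff_velocity.continuous_fderiv (by norm_num)).clm_apply continuous_const) s v

lemma fderiv_position_zero (h : CentralField L x X Y) (v ω : E n) :
    fderiv ℝ X (0, v) (0, ω) = 0 := by
  rw [funext h.position_eq, fderiv_const_add, fderiv_primitive_snd h.contDiff_velocity]
  simp

/-- First variation of the action along the field. -/
lemma fderiv_fieldAction (hL : ContDiff ℝ 2 L) (h : CentralField L x X Y) (s : ℝ) (v : E n)
    (τ : ℝ) (ω : E n) : fderiv ℝ (fieldAction L X Y) (s, v) (τ, ω) =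
      τ * L (X (s, v), Y (s, v)) +
        momentum L (X (s, v), Y (s, v)) (fderiv ℝ X (s, v) (0, ω)) := by
  have hsplit : ((τ, ω) : ℝ × E n) = (τ, 0) + (0, ω) := by simp
  have hG := h.contDiff_lagrangian hL
  rw [hsplit, map_add, fieldAction, fderiv_primitive_fst hG, fderiv_primitive_snd hG, smul_eq_mul,
    add_right_inj]
  have hd : ∀ σ, HasDerivAt
      (fun σ => momentum L (X (σ, v), Y (σ, v)) (fderiv ℝ X (σ, v) (0, ω)))
      (fderiv ℝ (fun p => L (X p, Y p)) (σ, v) (0, ω)) σ := by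
    intro σ
    have h1 := (h.isExtremal v).hasDerivAt_momentum hL σ
    simp only [h.deriv_position] at h1
    refine (h1.clm_apply (h.hasDerivAt_jacobi σ v ω)).congr_deriv ?_
    have h2 := (hasFDerivAt_of_contDiff_two hL (X (σ, v), Y (σ, v))).comp (σ, v)
      ((h.contDiff_position.differentiable (by norm_num) (σ, v)).hasFDerivAt.prodMk
        (h.contDiff_velocity.differentiable (by norm_num) (σ, v)).hasFDerivAt)
    have h3 : fderiv ℝ (fun p => L (X p, Y p)) (σ, v) = _ := h2.fderiv
    rw [h3, ContinuousLinearMap.comp_apply, ContinuousLinearMap.prod_apply,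
      fderiv_eq_force_add_momentum]
  rw [intervalIntegral.integral_eq_sub_of_hasDerivAt (fun σ _ => hd σ),
    h.fderiv_position_zero, map_zero, sub_zero]
  refine Continuous.intervalIntegrable ?_ _ _
  exact ((hG.continuous_fderiv (by norm_num)).comp (by fun_prop)).clm_apply continuous_const

end CentralField

end CentralField

section FieldGeometry

variable {n : ℕ} {L : E n × E n → ℝ} {x : E n} {X Y : ℝ × E n → E n}

/-- The fibred map `(θ, v) ↦ (θ, X (τ θ, v))`. -/
def fieldMap (τ : ℝ → ℝ) (X : ℝ × E n → E n) (p : ℝ × E n) : ℝ × E n := (p.1, X (τ p.1, p.2))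

/-- A superlinear lower bound with slope one, valid everywhere. -/
lemma IsTonelliLagrangian.exists_norm_le {k : ℕ} (hk : 2 ≤ k)
    (hL : IsTonelliLagrangian n (k : ℕ∞) L) : ∃ K : ℝ, ∀ x v : E n, ‖v‖ - K ≤ L (x, v) := by
  obtain ⟨R, hR⟩ := hL.superlinear 1
  obtain ⟨M, hM⟩ := hL.bddBelow hk
  refine ⟨|R| + |M|, fun x v => ?_⟩
  have h1 := abs_nonneg R
  have h2 := abs_nonneg M
  rcases le_total R ‖v‖ with h | h
  · have := hR x v h
    linarith
  · have := hM (x, v)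
    linarith [le_abs_self R, le_abs_self M]

namespace CentralField

lemma contDiff_fieldMap (h : CentralField L x X Y) {τ : ℝ → ℝ} (hτ : ContDiff ℝ 1 τ) :
    ContDiff ℝ 1 (fieldMap τ X) :=
  contDiff_fst.prodMk (h.contDiff_position.comp ((hτ.comp contDiff_fst).prodMk contDiff_snd))

lemma jacobi_bijective (h : CentralField L x X Y) {s : ℝ} (hs : s ≠ 0) (v : E n) :
    Function.Bijective fun ω => fderiv ℝ X (s, v) (0, ω) := by
  have hinj : Function.Injective
      ((fderiv ℝ X (s, v)).comp (ContinuousLinearMap.inr ℝ ℝ (E n))) := by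
    rw [injective_iff_map_eq_zero]
    exact fun ω hω => h.nondegenerate s v ω hs (by simpa using hω)
  have hsurj := LinearMap.surjective_of_injective (f := ((fderiv ℝ X (s, v)).comp
    (ContinuousLinearMap.inr ℝ ℝ (E n)) : E n →ₗ[ℝ] E n)) hinj
  exact ⟨hinj, hsurj⟩

/-- Away from time zero, the field is locally a fibred diffeomorphism. -/
lemma exists_localInverse (h : CentralField L x X Y) {τ : ℝ → ℝ} (hτ : ContDiff ℝ 1 τ)
    {p : ℝ × E n} (hp : τ p.1 ≠ 0) : ∃ e : OpenPartialHomeomorph (ℝ × E n) (ℝ × E n),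
      p ∈ e.source ∧ ⇑e = fieldMap τ X ∧ ContDiffAt ℝ 1 e.symm (fieldMap τ X p) := by
  set F' : (ℝ × E n) →L[ℝ] (ℝ × E n) := (ContinuousLinearMap.fst ℝ ℝ (E n)).prod
    ((fderiv ℝ X (τ p.1, p.2)).comp (((fderiv ℝ τ p.1).comp
      (ContinuousLinearMap.fst ℝ ℝ (E n))).prod (ContinuousLinearMap.snd ℝ ℝ (E n)))) with hF'
  have hd : HasFDerivAt (fieldMap τ X) F' p := by
    refine hasFDerivAt_fst.prodMk ?_
    exact (h.contDiff_position.differentiable (by norm_num) _).hasFDerivAt.comp p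
      (((hτ.differentiable (by norm_num) _).hasFDerivAt.comp p hasFDerivAt_fst).prodMk
        hasFDerivAt_snd)
  have hinj : Function.Injective F' := by
    rw [injective_iff_map_eq_zero]
    rintro ⟨a, ω⟩ h0
    simp only [hF', ContinuousLinearMap.prod_apply, ContinuousLinearMap.comp_apply,
      ContinuousLinearMap.coe_fst', ContinuousLinearMap.coe_snd', Prod.mk_eq_zero] at h0
    obtain ⟨rfl, h0⟩ := h0
    rw [map_zero] at h0
    rw [h.nondegenerate _ _ ω hp h0, Prod.mk_zero_zero]
  let A : (ℝ × E n) ≃L[ℝ] (ℝ × E n) :=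
    (LinearEquiv.ofInjectiveEndo (F' : (ℝ × E n) →ₗ[ℝ] (ℝ × E n)) hinj).toContinuousLinearEquiv
  have hA : HasFDerivAt (fieldMap τ X) (A : (ℝ × E n) →L[ℝ] (ℝ × E n)) p := by
    convert hd using 1
    exact ContinuousLinearMap.ext fun w => rfl
  have hP := (h.contDiff_fieldMap hτ).contDiffAt (x := p)
  exact ⟨hP.toOpenPartialHomeomorph _ hA (by norm_num),
    hP.mem_toOpenPartialHomeomorph_source hA (by norm_num), rfl,
    hP.to_localInverse hA (by norm_num)⟩

/-- The field action, read off in position space, is a local subsolution of the Hamilton–Jacobi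
equation: it calibrates the field. -/
lemma eventually_calibrated (hL : ContDiff ℝ 2 L) (hc : FiberConvex L) (h : CentralField L x X Y)
    {e : OpenPartialHomeomorph (ℝ × E n) (ℝ × E n)} (he : ⇑e = fieldMap id X) {p : ℝ × E n}
    (hp : p ∈ e.source) (hp0 : p.1 ≠ 0) (hes : ContDiffAt ℝ 1 e.symm (fieldMap id X p)) :
    ContDiffAt ℝ 1 (fieldAction L X Y ∘ e.symm) (fieldMap id X p) ∧
    ∀ᶠ z in 𝓝 (fieldMap id X p), ∀ q : E n,
      fderiv ℝ (fieldAction L X Y ∘ e.symm) z (1, q) ≤ L (z.2, q) := by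
  have hW : ContDiffAt ℝ 1 (fieldAction L X Y ∘ e.symm) (fieldMap id X p) :=
    (h.contDiff_fieldAction hL).contDiffAt.comp _ hes
  refine ⟨hW, ?_⟩
  have hsrc : ∀ᶠ z in 𝓝 (fieldMap id X p), z ∈ e.target :=
    e.open_target.mem_nhds (he ▸ e.map_source hp)
  have hne : ∀ᶠ z : ℝ × E n in 𝓝 (fieldMap id X p), z.1 ≠ 0 :=
    continuous_fst.continuousAt.eventually_ne hp0
  filter_upwards [hW.eventually (by norm_num), hsrc, hne] with z hWz hz hz0 q
  set w := e.symm z with hw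
  have hws : w ∈ e.source := e.map_target hz
  have hwz : fieldMap id X w = z := by rw [← he]; exact e.right_inv hz
  have hz1 : w.1 = z.1 := (congrArg Prod.fst hwz : (fieldMap id X w).1 = z.1)
  have hz2 : X w = z.2 := (congrArg Prod.snd hwz : (fieldMap id X w).2 = z.2)
  have hPd : HasFDerivAt (fieldMap id X)
      ((ContinuousLinearMap.fst ℝ ℝ (E n)).prod (fderiv ℝ X w)) w :=
    hasFDerivAt_fst.prodMk (h.contDiff_position.differentiable (by norm_num) w).hasFDerivAt
  have hWd : HasFDerivAt (fieldAction L X Y ∘ e.symm)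
      (fderiv ℝ (fieldAction L X Y ∘ e.symm) z) (fieldMap id X w) := by
    rw [hwz]; exact (hWz.differentiableAt (by norm_num)).hasFDerivAt
  have hcomp := hWd.comp w hPd
  have heq : (fieldAction L X Y ∘ e.symm) ∘ fieldMap id X =ᶠ[𝓝 w] fieldAction L X Y := by
    filter_upwards [e.open_source.mem_nhds hws] with y hy
    simp only [Function.comp, ← he, e.left_inv hy]
  have hfd := (hcomp.congr_of_eventuallyEq heq.symm).fderiv
  obtain ⟨ω, hω⟩ := (h.jacobi_bijective (hz1 ▸ hz0) w.2).2 (q - Y w)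
  have hXw : fderiv ℝ X w (1, ω) = q := by
    have : ((1, ω) : ℝ × E n) = (1, 0) + (0, ω) := by simp
    rw [this, map_add]
    have h1 := h.fderiv_position_time w.1 w.2 1
    simp only [Prod.mk.eta, one_smul] at h1 hω
    rw [h1, hω]
    abel
  have h2 := h.fderiv_fieldAction hL w.1 w.2 1 ω
  simp only [Prod.mk.eta, one_mul] at h2 hω
  rw [hω, hfd, ContinuousLinearMap.comp_apply, ContinuousLinearMap.prod_apply, hXw,
    ContinuousLinearMap.coe_fst', hz2] at h2
  rw [h2]
  exact weierstrass_excess hL hc _ _ _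

/-- Orbits of bounded action have bounded initial velocity. -/
lemma exists_velocity_bound {k : ℕ} (hk : 2 ≤ k) (hL : IsTonelliLagrangian n (k : ℕ∞) L)
    (h : CentralField L x X Y) (A : ℝ) : ∃ R : ℝ, ∀ (s : ℝ) (v : E n), 1 ≤ s →
      fieldAction L X Y (s, v) ≤ A → ‖v‖ ≤ R := by
  have h2 := hL.contDiff_two hk
  obtain ⟨K, hK⟩ := hL.exists_norm_le hk
  obtain ⟨e, he⟩ := continuous_periodic_bounded (continuous_energy h2)
    (fun x v m => by simp only [energy, hL.momentum_periodic, hL.periodic]) (|A| + K + 1)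
  obtain ⟨R, hR⟩ := hL.energy_coercive hk e
  refine ⟨R, fun s v hs hA => ?_⟩
  obtain ⟨σ, hσ⟩ : ∃ σ, ‖Y (σ, v)‖ ≤ |A| + K + 1 := by
    by_contra! hlt
    have hcont : Continuous fun σ => L (X (σ, v), Y (σ, v)) :=
      (h.contDiff_lagrangian h2).continuous.comp (by fun_prop)
    have h3 : ∫ _ in (0 : ℝ)..s, (|A| + 1) ≤ fieldAction L X Y (s, v) :=
      intervalIntegral.integral_mono_on (by linarith) intervalIntegrable_const
        (hcont.intervalIntegrable _ _) fun σ _ => by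
          have := hK (X (σ, v)) (Y (σ, v))
          linarith [hlt σ]
    rw [intervalIntegral.integral_const, smul_eq_mul, sub_zero] at h3
    nlinarith [abs_nonneg A, le_abs_self A]
  refine hR x v ?_
  have hE := (h.isExtremal v).energy_eq h2 0 σ
  simp only [h.deriv_position, h.position_zero, h.velocity_zero] at hE
  rw [hE]
  exact (le_abs_self _).trans (he _ _ hσ)

end CentralField

lemma IsELFlow.contDiff_one {k : ℕ} (hk : 2 ≤ k) {φ : ℝ → E n × E n → E n × E n}
    (hφ : IsELFlow n k L φ) : ContDiff ℝ 1 fun p : ℝ × (E n × E n) => φ p.1 p.2 := by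
  refine hφ.1.of_le ?_
  have h : ((1 : ℕ) : ℕ∞) ≤ ((k - 1 : ℕ) : ℕ∞) := by exact_mod_cast (by omega : 1 ≤ k - 1)
  exact WithTop.coe_le_coe.2 h

/-- The extremals leaving a point, under a flow without conjugate points. -/
lemma IsELFlow.centralField {k : ℕ} (hk : 2 ≤ k) {φ : ℝ → E n × E n → E n × E n}
    (hφ : IsELFlow n k L φ) (hnc : NoConjugatePoints n φ) (x : E n) :
    CentralField L x (fun p => (φ p.1 (x, p.2)).1) (fun p => (φ p.1 (x, p.2)).2) := by
  have hφ1 := hφ.contDiff_one hk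
  have hc : ContDiff ℝ 1 fun p : ℝ × E n => φ p.1 (x, p.2) :=
    hφ1.comp (contDiff_fst.prodMk (contDiff_const.prodMk contDiff_snd))
  refine ⟨contDiff_fst.comp hc, contDiff_snd.comp hc, fun v => ?_, fun v => ?_,
    fun v => (hφ.2.2 x v).1, fun s v => ((hφ.2.2 x v).2 s).symm, fun s v ω hs h0 => ?_⟩
  · simp [hφ.2.1]
  · simp [hφ.2.1]
  · refine hnc (x, v) s hs ω ?_
    have hφs : HasFDerivAt (φ s) (fderiv ℝ (φ s) (x, v)) (x, v) :=
      ((hφ1.comp (contDiff_const.prodMk contDiff_id)).differentiable (by norm_num)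
        (x, v)).hasFDerivAt
    have h1 := (hasFDerivAt_fst.comp (x, v) hφs).comp v (hasFDerivAt_prodMk_right x v)
    have h2 := ((contDiff_fst.comp hc).differentiable (by norm_num) (s, v)).hasFDerivAt.comp v
      (hasFDerivAt_prodMk_right s v)
    have h3 := congrArg (fun A : E n →L[ℝ] E n => A ω) (h1.unique h2)
    simp only [ContinuousLinearMap.comp_apply, ContinuousLinearMap.inr_apply,
      ContinuousLinearMap.coe_fst'] at h3
    rw [h3]
    exact h0

end FieldGeometry

section FiniteAction

variable {n : ℕ} {L : E n × E n → ℝ} {γ g : ℝ → E n}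

/-- `γ` is an absolutely continuous curve with derivative `g` and locally finite action. -/
structure FiniteActionCurve (L : E n × E n → ℝ) (γ g : ℝ → E n) : Prop where
  integrable : ∀ a b, IntervalIntegrable g volume a b
  sub_eq_integral : ∀ s t, γ t - γ s = ∫ u in s..t, g u
  integrable_action : ∀ a b, IntervalIntegrable (fun s => L (γ s, g s)) volume a b

lemma AbsolutelyContinuousOnInterval.of_dist_le {X Y : Type*} [PseudoMetricSpace X]
    [PseudoMetricSpace Y] {f : ℝ → X} {F : ℝ → Y} {a b : ℝ}
    (hF : AbsolutelyContinuousOnInterval F a b)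
    (h : ∀ s ∈ uIcc a b, ∀ t ∈ uIcc a b, dist (f s) (f t) ≤ dist (F s) (F t)) :
    AbsolutelyContinuousOnInterval f a b := by
  rw [absolutelyContinuousOnInterval_iff] at hF ⊢
  intro ε hε
  obtain ⟨δ, hδ, H⟩ := hF ε hε
  refine ⟨δ, hδ, fun I hI hlt => lt_of_le_of_lt (Finset.sum_le_sum fun i hi => ?_) (H I hI hlt)⟩
  exact h _ (hI.1 i hi).1 _ (hI.1 i hi).2

namespace FiniteActionCurve

lemma of_hasDerivAt (hL : Continuous L) (hγ : ∀ s, HasDerivAt γ (g s) s) (hg : Continuous g) :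
    FiniteActionCurve L γ g where
  integrable a b := hg.intervalIntegrable a b
  sub_eq_integral _ _ := (intervalIntegral.integral_eq_sub_of_hasDerivAt (fun u _ => hγ u)
    (hg.intervalIntegrable _ _)).symm
  integrable_action a b := (hL.comp ((continuous_iff_continuousAt.2
    fun s => (hγ s).continuousAt).prodMk hg)).intervalIntegrable a b

lemma eq_add (h : FiniteActionCurve L γ g) (s : ℝ) : γ = fun t => γ s + ∫ u in s..t, g u := by
  funext t
  rw [← h.sub_eq_integral]
  abel

lemma continuous (h : FiniteActionCurve L γ g) : Continuous γ := by
  rw [h.eq_add 0]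
  exact continuous_const.add (intervalIntegral.continuous_primitive h.integrable 0)

lemma absolutelyContinuous_comp (h : FiniteActionCurve L γ g) {W : ℝ × E n → ℝ} {K : ℝ≥0}
    {s t : ℝ} (hst : s ≤ t) {N : Set (ℝ × E n)} (hW : LipschitzOnWith K W N)
    (hN : ∀ τ ∈ Icc s t, (τ, γ τ) ∈ N) :
    AbsolutelyContinuousOnInterval (fun τ => W (τ, γ τ)) s t := by
  have hI : ∀ a b, IntervalIntegrable (fun τ => (K : ℝ) * (1 + ‖g τ‖)) volume a b := fun a b =>
    (intervalIntegrable_const.add (h.integrable a b).norm).const_mul _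
  refine ((hI s t).absolutelyContinuousOnInterval_intervalIntegral
    (c := s) left_mem_uIcc).of_dist_le ?_
  rw [uIcc_of_le hst]
  suffices H : ∀ a ∈ Icc s t, ∀ b ∈ Icc s t, a ≤ b → dist (W (a, γ a)) (W (b, γ b)) ≤
      dist (∫ τ in s..a, (K : ℝ) * (1 + ‖g τ‖)) (∫ τ in s..b, (K : ℝ) * (1 + ‖g τ‖)) by
    intro a ha b hb
    rcases le_total a b with hab | hab
    · exact H a ha b hb hab
    · rw [dist_comm, dist_comm (∫ τ in s..a, _)]
      exact H b hb a ha hab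
  intro a ha b hb hab
  refine (hW.dist_le_mul _ (hN a ha) _ (hN b hb)).trans ?_
  rw [dist_comm (∫ τ in s..a, _), Real.dist_eq,
    intervalIntegral.integral_interval_sub_left (hI _ _) (hI _ _)]
  refine le_trans ?_ (le_abs_self _)
  rw [intervalIntegral.integral_const_mul,
    intervalIntegral.integral_add intervalIntegrable_const (h.integrable a b).norm]
  refine mul_le_mul_of_nonneg_left ?_ K.2
  have h1 : ‖γ b - γ a‖ ≤ ∫ τ in a..b, ‖g τ‖ := by
    rw [h.sub_eq_integral]
    exact intervalIntegral.norm_integral_le_integral_norm hab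
  have h2 : 0 ≤ ∫ τ in a..b, ‖g τ‖ := (norm_nonneg _).trans h1
  simp only [intervalIntegral.integral_const, smul_eq_mul, mul_one, Prod.dist_eq]
  rw [dist_comm a, dist_comm (γ a), Real.dist_eq, dist_eq_norm, abs_of_nonneg (sub_nonneg.2 hab)]
  exact max_le (by linarith) (by linarith)

/-- A local subsolution of the Hamilton–Jacobi equation grows along a curve at most by
the action of the curve. -/
lemma exists_sub_le_action (h : FiniteActionCurve L γ g) {W : ℝ × E n → ℝ} {s₀ : ℝ}
    (hW : ContDiffAt ℝ 1 W (s₀, γ s₀))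
    (hsub : ∀ᶠ z in 𝓝 (s₀, γ s₀), ∀ q : E n, fderiv ℝ W z (1, q) ≤ L (z.2, q)) :
    ∃ δ > 0, ∀ s ∈ Metric.ball s₀ δ, ∀ t ∈ Metric.ball s₀ δ, s ≤ t →
      W (t, γ t) - W (s, γ s) ≤ ∫ τ in s..t, L (γ τ, g τ) := by
  obtain ⟨K, N, hN, hK⟩ := hW.exists_lipschitzOnWith
  have hcont : Continuous fun τ => (τ, γ τ) := continuous_id.prodMk h.continuous
  have hev : ∀ᶠ τ in 𝓝 s₀, (τ, γ τ) ∈ N ∧ ContDiffAt ℝ 1 W (τ, γ τ) ∧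
      ∀ q : E n, fderiv ℝ W (τ, γ τ) (1, q) ≤ L (γ τ, q) :=
    hcont.continuousAt.eventually
      ((eventually_mem_set.2 hN).and ((hW.eventually (by norm_num)).and hsub))
  obtain ⟨δ, hδ, H⟩ := Metric.eventually_nhds_iff_ball.1 hev
  refine ⟨δ, hδ, fun s hs t ht hst => ?_⟩
  have hIcc : ∀ τ ∈ Icc s t, τ ∈ Metric.ball s₀ δ := by
    intro τ hτ
    rw [Real.ball_eq_Ioo] at hs ht ⊢
    exact ⟨hs.1.trans_le hτ.1, hτ.2.trans_lt ht.2⟩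
  have hac := h.absolutelyContinuous_comp hst hK fun τ hτ => (H τ (hIcc τ hτ)).1
  rw [← hac.integral_deriv_eq_sub]
  refine intervalIntegral.integral_mono_ae_restrict hst hac.intervalIntegrable_deriv
    (h.integrable_action s t) ?_
  rw [EventuallyLE, ae_restrict_iff' measurableSet_Icc]
  filter_upwards [(h.integrable s t).ae_hasDerivAt_integral] with τ hτ hmem
  have hmem' : τ ∈ uIcc s t := by rwa [uIcc_of_le hst]
  have hγ : HasDerivAt γ (g τ) τ := by
    rw [h.eq_add s]
    exact (hτ hmem' s left_mem_uIcc).const_add _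
  obtain ⟨-, h1, h2⟩ := H τ (hIcc τ hmem)
  have h3 := (h1.differentiableAt (by norm_num)).hasFDerivAt.comp_hasDerivAt τ
    ((hasDerivAt_id τ).prodMk hγ)
  have h4 : deriv (fun τ => W (τ, γ τ)) τ = _ := h3.deriv
  rw [h4]
  exact h2 _

end FiniteActionCurve

end FiniteAction

section Lifting

variable {n : ℕ} {L : E n × E n → ℝ} {x : E n} {X Y : ℝ × E n → E n} {γ g : ℝ → E n}

/-- `w` lifts `γ` through the field on `[1, t]`, and the field action along the lift grows at most
by the action of `γ`. -/
structure IsCalibratedLift (L : E n × E n → ℝ) (X Y : ℝ × E n → E n) (γ g : ℝ → E n) (v₀ : E n)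
    (t : ℝ) (w : ℝ → E n) : Prop where
  continuousOn : ContinuousOn w (Icc 1 t)
  apply_one : w 1 = v₀
  position_eq : ∀ s ∈ Icc 1 t, X (s, w s) = γ s
  action_le : ∀ s ∈ Icc 1 t, fieldAction L X Y (s, w s) ≤
    fieldAction L X Y (1, v₀) + ∫ τ in (1 : ℝ)..s, L (γ τ, g τ)

namespace CentralField

/-- Away from time zero a curve lifts locally, and locally uniquely, through the field. -/
lemma exists_local_lift (hL : ContDiff ℝ 2 L) (hc : FiberConvex L) (h : CentralField L x X Y)
    (hγ : FiniteActionCurve L γ g) {s₀ : ℝ} (hs₀ : s₀ ≠ 0) {v : E n} (hv : X (s₀, v) = γ s₀) :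
    ∃ ŵ : ℝ → E n, ∃ δ > 0, ∃ U ∈ 𝓝 v, ContinuousOn ŵ (Metric.ball s₀ δ) ∧
      (∀ s ∈ Metric.ball s₀ δ, X (s, ŵ s) = γ s) ∧
      (∀ s ∈ Metric.ball s₀ δ, ∀ v' ∈ U, X (s, v') = γ s → v' = ŵ s) ∧
      ∀ s ∈ Metric.ball s₀ δ, ∀ t ∈ Metric.ball s₀ δ, s ≤ t →
        fieldAction L X Y (t, ŵ t) - fieldAction L X Y (s, ŵ s) ≤ ∫ τ in s..t, L (γ τ, g τ) := by
  obtain ⟨e, hp, he, hes⟩ := h.exists_localInverse (τ := id) contDiff_id (p := (s₀, v)) hs₀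
  obtain ⟨hW, hsub⟩ := h.eventually_calibrated hL hc he hp hs₀ hes
  have hbase : fieldMap id X (s₀, v) = (s₀, γ s₀) := by simp [fieldMap, hv]
  rw [hbase] at hW hsub
  obtain ⟨δ₁, hδ₁, hchain⟩ := hγ.exists_sub_le_action hW hsub
  have hcont : Continuous fun τ => (τ, γ τ) := continuous_id.prodMk hγ.continuous
  have htarget : ∀ᶠ s in 𝓝 s₀, (s, γ s) ∈ e.target :=
    hcont.continuousAt.eventually (e.open_target.mem_nhds
      (hbase ▸ he ▸ e.map_source hp : (s₀, γ s₀) ∈ e.target))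
  obtain ⟨N, hN, U, hU, hNU⟩ := mem_nhds_prod_iff.1 (e.open_source.mem_nhds hp)
  obtain ⟨δ₂, hδ₂, hev⟩ :=
    Metric.eventually_nhds_iff_ball.1 (htarget.and (eventually_mem_set.2 hN))
  have hsymm : ∀ s ∈ Metric.ball s₀ δ₂,
      (e.symm (s, γ s)).1 = s ∧ X (e.symm (s, γ s)) = γ s := by
    intro s hs
    have h1 : fieldMap id X (e.symm (s, γ s)) = (s, γ s) := by
      rw [← he]; exact e.right_inv (hev s hs).1
    exact Prod.ext_iff.1 h1
  have hpair : ∀ s ∈ Metric.ball s₀ δ₂, (s, (e.symm (s, γ s)).2) = e.symm (s, γ s) :=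
    fun s hs => Prod.ext (hsymm s hs).1.symm rfl
  have hsub₁ : Metric.ball s₀ (min δ₁ δ₂) ⊆ Metric.ball s₀ δ₁ :=
    Metric.ball_subset_ball (min_le_left _ _)
  have hsub₂ : Metric.ball s₀ (min δ₁ δ₂) ⊆ Metric.ball s₀ δ₂ :=
    Metric.ball_subset_ball (min_le_right _ _)
  refine ⟨fun s => (e.symm (s, γ s)).2, min δ₁ δ₂, lt_min hδ₁ hδ₂, U, hU, ?_, ?_, ?_, ?_⟩
  · exact continuous_snd.comp_continuousOn (e.continuousOn_symm.comp hcont.continuousOn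
      fun s hs => (hev s (hsub₂ hs)).1)
  · intro s hs
    rw [hpair s (hsub₂ hs)]
    exact (hsymm s (hsub₂ hs)).2
  · intro s hs v' hv' hX
    have h1 : e (s, v') = (s, γ s) := by rw [he, fieldMap, id, hX]
    have h2 : (s, v') ∈ e.source := hNU ⟨(hev s (hsub₂ hs)).2, hv'⟩
    beta_reduce
    rw [← h1, e.left_inv h2]
  · intro s hs t ht hst
    rw [hpair s (hsub₂ hs), hpair t (hsub₂ ht)]
    exact hchain s (hsub₁ hs) t (hsub₁ ht) hst

/-- A limit of times up to which calibrated lifts exist can be passed. -/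
lemma exists_lift_past {k : ℕ} (hk : 2 ≤ k) (hL : IsTonelliLagrangian n (k : ℕ∞) L)
    (h : CentralField L x X Y) (hγ : FiniteActionCurve L γ g) {v₀ : E n} {t : ℝ}
    (ht : t ∈ closure {s | 1 ≤ s ∧ ∃ w, IsCalibratedLift L X Y γ g v₀ s w}) :
    ∃ δ > 0, ∀ t' ∈ Ico t (t + δ), ∃ w, IsCalibratedLift L X Y γ g v₀ t' w := by
  have h2 := hL.contDiff_two hk
  obtain ⟨s, hs, hst⟩ := mem_closure_iff_seq_limit.1 ht
  choose h1 w hw using hs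
  have ht1 : 1 ≤ t := ge_of_tendsto' hst h1
  have hI : Continuous fun a => fieldAction L X Y (1, v₀) + ∫ τ in (1 : ℝ)..a, L (γ τ, g τ) :=
    continuous_const.add (intervalIntegral.continuous_primitive hγ.integrable_action 1)
  obtain ⟨A, hA⟩ := ((hI.tendsto t).comp hst).bddAbove_range
  obtain ⟨R, hR⟩ := h.exists_velocity_bound hk hL A
  have hmem : ∀ j, w j (s j) ∈ Metric.closedBall (0 : E n) R := fun j => by
    rw [mem_closedBall_zero_iff]
    exact hR _ _ (h1 j) (((hw j).action_le _ (right_mem_Icc.2 (h1 j))).trans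
      (hA (mem_range_self j)))
  obtain ⟨v, -, ψ, hψ, hv⟩ := (isCompact_closedBall (0 : E n) R).tendsto_subseq hmem
  have hsψ : Tendsto (fun j => s (ψ j)) atTop (𝓝 t) := hst.comp hψ.tendsto_atTop
  have hX : X (t, v) = γ t := by
    refine tendsto_nhds_unique (f := fun j => X (s (ψ j), w (ψ j) (s (ψ j))))
      ((h.contDiff_position.continuous.tendsto _).comp (hsψ.prodMk_nhds hv)) ?_
    refine ((hγ.continuous.tendsto t).comp hsψ).congr fun j => ?_
    exact ((hw (ψ j)).position_eq _ (right_mem_Icc.2 (h1 _))).symm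
  obtain ⟨ŵ, δ, hδ, U, hU, hŵc, hŵX, huniq, hŵA⟩ :=
    h.exists_local_lift h2 (hL.fiberConvex hk) hγ (by linarith : t ≠ 0) hX
  obtain ⟨j, hjb, hjU⟩ := ((hsψ.eventually_mem (Metric.ball_mem_nhds t hδ)).and
    (hv.eventually_mem hU)).exists
  set a := s (ψ j) with ha
  set wa := w (ψ j) with hwa
  have hlift := hw (ψ j)
  rw [← ha, ← hwa] at hlift
  have ha1 : 1 ≤ a := h1 _
  have hjoin : wa a = ŵ a := huniq a hjb _ hjU (hlift.position_eq a (right_mem_Icc.2 ha1))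
  rw [Real.ball_eq_Ioo] at *
  refine ⟨δ, hδ, fun t' ht' => ⟨fun s => if s ≤ a then wa s else ŵ s, ?_⟩⟩
  have hball : ∀ s, a ≤ s → s ≤ t' → s ∈ Ioo (t - δ) (t + δ) := fun s h3 h4 =>
    ⟨hjb.1.trans_le h3, h4.trans_lt ht'.2⟩
  refine ⟨?_, by simp [ha1, hlift.apply_one], ?_, ?_⟩
  · refine ContinuousOn.if ?_ ?_ ?_
    · intro s hs
      have hsa : s = a := by
        have := frontier_le_subset_eq continuous_id continuous_const hs.2
        exact this
      rw [hsa, hjoin]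
    · refine hlift.continuousOn.mono fun s hs => ?_
      have hcl : s ≤ a := by
        have := closure_le_eq continuous_id (continuous_const (y := a)) ▸ hs.2
        exact this
      exact ⟨hs.1.1, hcl⟩
    · refine hŵc.mono fun s hs => ?_
      have hcl : a ≤ s := by
        simp only [not_le] at hs
        exact closure_lt_subset_le continuous_const continuous_id hs.2
      exact hball s hcl hs.1.2
  · intro s hs
    by_cases hsa : s ≤ a
    · simp only [hsa, if_true]
      exact hlift.position_eq s ⟨hs.1, hsa⟩
    · simp only [hsa, if_false]
      exact hŵX s (hball s (not_le.1 hsa).le hs.2)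
  · intro s hs
    by_cases hsa : s ≤ a
    · simp only [hsa, if_true]
      exact hlift.action_le s ⟨hs.1, hsa⟩
    · simp only [hsa, if_false]
      have h3 := hŵA a hjb s (hball s (not_le.1 hsa).le hs.2) (not_le.1 hsa).le
      have h4 := hlift.action_le a (right_mem_Icc.2 ha1)
      rw [hjoin] at h4
      rw [← intervalIntegral.integral_add_adjacent_intervals (hγ.integrable_action 1 a)
        (hγ.integrable_action a s)]
      linarith

/-- Every curve of finite action starting on the field lifts through the field. -/
lemma exists_lift {k : ℕ} (hk : 2 ≤ k) (hL : IsTonelliLagrangian n (k : ℕ∞) L)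
    (h : CentralField L x X Y) (hγ : FiniteActionCurve L γ g) {v₀ : E n} (hv₀ : X (1, v₀) = γ 1)
    {S : ℝ} (hS : 1 ≤ S) : ∃ w, IsCalibratedLift L X Y γ g v₀ S w := by
  set G : Set ℝ := {s | 1 ≤ s ∧ ∃ w, IsCalibratedLift L X Y γ g v₀ s w} with hG
  have h1 : (1 : ℝ) ∈ G := by
    refine ⟨le_rfl, fun _ => v₀, continuousOn_const, rfl, ?_, ?_⟩
    · intro s hs
      obtain rfl : s = 1 := le_antisymm hs.2 hs.1
      exact hv₀
    · intro s hs
      obtain rfl : s = 1 := le_antisymm hs.2 hs.1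
      simp
  have hclosed : IsClosed G := by
    refine isClosed_of_closure_subset fun t ht => ?_
    obtain ⟨δ, hδ, H⟩ := h.exists_lift_past hk hL hγ ht
    exact ⟨closure_minimal (fun s hs => hs.1) isClosed_Ici ht, H t ⟨le_rfl, by linarith⟩⟩
  refine (IsClosed.Icc_subset_of_forall_exists_gt (hclosed.inter isClosed_Icc) h1 ?_
    (right_mem_Icc.2 hS)).2
  intro t ht y hy
  obtain ⟨δ, hδ, H⟩ := h.exists_lift_past hk hL hγ (subset_closure ht.1)
  rw [mem_Ioi] at hy
  refine ⟨min y (t + δ / 2), ⟨?_, H _ ⟨?_, ?_⟩⟩, ?_, min_le_left _ _⟩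
  · exact le_min (ht.1.1.trans hy.le) (by linarith [ht.1.1])
  · exact le_min hy.le (by linarith)
  · exact (min_le_right _ _).trans_lt (by linarith)
  · exact lt_min hy (by linarith)

end CentralField

end Lifting

section Minimization

variable {n : ℕ} {L : E n × E n → ℝ} {x : E n} {X Y : ℝ × E n → E n} {γ g : ℝ → E n}

namespace CentralField

lemma isLocalHomeomorph_fieldMap (h : CentralField L x X Y) {τ : ℝ → ℝ} (hτ : ContDiff ℝ 1 τ)
    (hτ0 : ∀ θ, τ θ ≠ 0) : IsLocalHomeomorph (fieldMap τ X) := fun p =>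
  let ⟨e, hp, he, _⟩ := h.exists_localInverse hτ (hτ0 p.1)
  ⟨e, hp, he.symm⟩

/-- Two lifts starting from the same point agree at the end when one lifts a homotopy, relative to
the endpoints, from an orbit of the field. -/
lemma lift_end_eq (h : CentralField L x X Y) {S : ℝ} (hS : 1 ≤ S) {v₀ : E n}
    {Γ : unitInterval → ℝ → E n} (hΓ : Continuous fun q : unitInterval × ℝ => Γ q.1 q.2)
    (hΓ0 : ∀ s, Γ 0 s = X (s, v₀)) (hΓS : ∀ i, Γ i S = X (S, v₀))
    {w : unitInterval → ℝ → E n} (hw : ∀ i, ContinuousOn (w i) (Icc 1 S))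
    (hw1 : ∀ i, w i 1 = v₀) (hwX : ∀ i, ∀ s ∈ Icc 1 S, X (s, w i s) = Γ i s)
    (i : unitInterval) : w i S = v₀ := by
  have hS0 : 0 < S := by linarith
  have hlog : 0 ≤ Real.log S := Real.log_nonneg hS
  have hhomeo := h.isLocalHomeomorph_fieldMap (τ := Real.exp) Real.contDiff_exp Real.exp_ne_zero
  have hsep := T2Space.isSeparatedMap (fieldMap Real.exp X)
  let σ : unitInterval → ℝ := fun θ => Real.exp (θ * Real.log S)
  have hσc : Continuous σ := by fun_prop
  have hσ0 : σ 0 = 1 := by simp [σ]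
  have hσ1 : σ 1 = S := by simp [σ, Real.exp_log hS0]
  have hσ : ∀ θ, σ θ ∈ Icc 1 S := fun θ => by
    refine ⟨Real.one_le_exp (mul_nonneg θ.2.1 hlog), ?_⟩
    rw [← hσ1]
    simpa only [σ, Real.exp_le_exp, Icc.coe_one] using mul_le_mul_of_nonneg_right θ.2.2 hlog
  let lift : unitInterval → C(unitInterval, ℝ × E n) := fun i =>
    ⟨fun θ => (θ * Real.log S, w i (σ θ)), Continuous.prodMk (by fun_prop)
      ((hw i).comp_continuous hσc hσ)⟩
  have hX1 : ∀ i, Γ i 1 = X (1, v₀) := fun i => by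
    rw [← hwX i 1 (left_mem_Icc.2 hS), hw1]
  let path : unitInterval → C(unitInterval, ℝ × E n) := fun i =>
    ⟨fun θ => (θ * Real.log S, Γ i (σ θ)), Continuous.prodMk (by fun_prop)
      (hΓ.comp (continuous_const.prodMk hσc))⟩
  let H : (path 0).HomotopyRel (path 1) {0, 1} :=
    { toFun := fun q => (q.2 * Real.log S, Γ q.1 (σ q.2))
      continuous_toFun := Continuous.prodMk (by fun_prop)
        (hΓ.comp (continuous_fst.prodMk (hσc.comp continuous_snd)))
      map_zero_left := fun _ => rfl
      map_one_left := fun _ => rfl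
      prop' := by
        rintro i θ (rfl | rfl)
        · simp [path, hσ0, hX1]
        · simp [path, hσ1, hΓS] }
  have hend := hhomeo.monodromy_theorem hsep H lift
    (fun i θ => Prod.ext rfl (hwX i (σ θ) (hσ θ)))
    (fun i => Prod.ext rfl (by simp [lift, hσ0, hw1])) i
  have hzero : ⇑(lift 0) = fun θ : unitInterval => (θ * Real.log S, v₀) := by
    refine hsep.eq_of_comp_eq hhomeo.isLocallyInjective (lift 0).continuous (by fun_prop) ?_ 0 ?_
    · funext θ
      exact Prod.ext rfl ((hwX 0 (σ θ) (hσ θ)).trans (hΓ0 _))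
    · exact Prod.ext rfl (by simp [lift, hσ0, hw1])
  rw [hzero] at hend
  simpa [lift, hσ1] using congrArg Prod.snd hend

/-- An orbit of the field minimizes the action, away from the center of the field, among
continuously differentiable curves with the same endpoints. -/
lemma action_le_of_contDiff {k : ℕ} (hk : 2 ≤ k) (hL : IsTonelliLagrangian n (k : ℕ∞) L)
    (h : CentralField L x X Y) (hγ : ∀ s, HasDerivAt γ (g s) s) (hg : Continuous g) {S : ℝ}
    (hS : 1 ≤ S) {v₀ : E n} (h1 : X (1, v₀) = γ 1) (hXS : X (S, v₀) = γ S) :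
    ∫ s in (1 : ℝ)..S, L (X (s, v₀), Y (s, v₀)) ≤ ∫ s in (1 : ℝ)..S, L (γ s, g s) := by
  have h2 := hL.contDiff_two hk
  have hγc : Continuous γ := continuous_iff_continuousAt.2 fun s => (hγ s).continuousAt
  have hXc := h.contDiff_position.continuous
  have hYc := h.contDiff_velocity.continuous
  let Γ : unitInterval → ℝ → E n := fun i s => X (s, v₀) + (i : ℝ) • (γ s - X (s, v₀))
  have hΓ : ∀ i, FiniteActionCurve L (Γ i)
      fun s => Y (s, v₀) + (i : ℝ) • (g s - Y (s, v₀)) := fun i => by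
    refine .of_hasDerivAt h2.continuous (fun s => ?_) (by fun_prop)
    exact (h.hasDerivAt_position s v₀).add
      (((hγ s).sub (h.hasDerivAt_position s v₀)).const_smul (i : ℝ))
  have hΓ1 : ∀ i, X (1, v₀) = Γ i 1 := fun i => by simp [Γ, h1]
  choose w hw using fun i => h.exists_lift hk hL (hΓ i) (hΓ1 i) hS
  have hend : w 1 S = v₀ := h.lift_end_eq hS (Γ := Γ) (by fun_prop) (fun s => by simp [Γ])
    (fun i => by simp [Γ, hXS]) (fun i => (hw i).continuousOn) (fun i => (hw i).apply_one)
    (fun i => (hw i).position_eq) 1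
  have hle := (hw 1).action_le S (right_mem_Icc.2 hS)
  rw [hend] at hle
  have hI : ∀ a b, IntervalIntegrable (fun s => L (X (s, v₀), Y (s, v₀))) volume a b :=
    fun a b => ((h.contDiff_lagrangian h2).continuous.comp (by fun_prop)).intervalIntegrable a b
  have hsplit := intervalIntegral.integral_add_adjacent_intervals (hI 0 1) (hI 1 S)
  simp only [Icc.coe_one, one_smul, add_sub_cancel, Γ, fieldAction, primitive] at hle
  linarith

end CentralField

end Minimization

section ExtremalsMinimize

variable {n k : ℕ} {L : E n × E n → ℝ} {φ : ℝ → E n × E n → E n × E n} {c γ g : ℝ → E n}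

lemma IsELFlow.apply_extremal (hk : 2 ≤ k) (hL : IsTonelliLagrangian n (k : ℕ∞) L)
    (hφ : IsELFlow n k L φ) (hc : IsExtremal n L c) (a s : ℝ) :
    φ s (c a, deriv c a) = (c (s + a), deriv c (s + a)) := by
  have h2 := hL.contDiff_two hk
  have hd : deriv (fun t => c (t + a)) = fun t => deriv c (t + a) :=
    funext fun t => deriv_comp_add_const c a t
  have heq : (fun t => (φ t (c a, deriv c a)).1) = fun t => c (t + a) := by
    refine (hφ.2.2 _ _).1.unique h2 (hL.fiberConvex hk) (hc.shift h2 a) (t := 0) ?_ ?_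
    · simp [hφ.2.1]
    · rw [← (hφ.2.2 _ _).2, hφ.2.1, hd]
      simp
  refine Prod.ext (congrFun heq s) ?_
  rw [(hφ.2.2 _ _).2, heq, hd]

lemma FiniteActionCurve.comp_sub_one (h : FiniteActionCurve L γ g) :
    FiniteActionCurve L (fun s => γ (s - 1)) fun s => g (s - 1) where
  integrable a b := by simpa using (h.integrable (a - 1) (b - 1)).comp_sub_right 1
  sub_eq_integral s t := by
    rw [intervalIntegral.integral_comp_sub_right g 1, h.sub_eq_integral]
  integrable_action a b := by
    simpa using (h.integrable_action (a - 1) (b - 1)).comp_sub_right 1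

/-- Without conjugate points, extremals minimize the action among continuously differentiable
curves with the same endpoints. -/
lemma IsExtremal.action_le_of_contDiff (hk : 2 ≤ k) (hL : IsTonelliLagrangian n (k : ℕ∞) L)
    (hφ : IsELFlow n k L φ) (hnc : NoConjugatePoints n φ) (hc : IsExtremal n L c)
    (hγ : ∀ s, HasDerivAt γ (g s) s) (hg : Continuous g) {T : ℝ} (hT : 0 ≤ T)
    (h0 : γ 0 = c 0) (h1 : γ T = c T) :
    ∫ s in (0 : ℝ)..T, L (c s, deriv c s) ≤ ∫ s in (0 : ℝ)..T, L (γ s, g s) := by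
  have hflow := hφ.apply_extremal hk hL hc (-1)
  have h := (hφ.centralField hk hnc (c (-1))).action_le_of_contDiff hk hL
    (γ := fun s => γ (s - 1)) (g := fun s => g (s - 1)) (S := T + 1) (v₀ := deriv c (-1))
    (fun s => (hγ (s - 1)).comp_sub_const s 1) (by fun_prop) (by linarith)
    (by simp [hflow, h0]) (by simp [hflow, h1])
  simp only [hflow, ← sub_eq_add_neg] at h
  rw [intervalIntegral.integral_comp_sub_right (fun s => L (c s, deriv c s)) 1,
    intervalIntegral.integral_comp_sub_right (fun s => L (γ s, g s)) 1] at h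
  simpa using h

/-- Without conjugate points, extremals minimize the action among absolutely continuous curves
with the same endpoints. -/
lemma IsExtremal.action_le (hk : 2 ≤ k) (hL : IsTonelliLagrangian n (k : ℕ∞) L)
    (hφ : IsELFlow n k L φ) (hnc : NoConjugatePoints n φ) (hc : IsExtremal n L c)
    (hγ : FiniteActionCurve L γ g) {T : ℝ} (hT : 0 ≤ T) (h0 : γ 0 = c 0) (h1 : γ T = c T) :
    ∫ s in (0 : ℝ)..T, L (c s, deriv c s) ≤ ∫ s in (0 : ℝ)..T, L (γ s, g s) := by
  have h2 := hL.contDiff_two hk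
  have hflow := hφ.apply_extremal hk hL hc (-1)
  have hfield := hφ.centralField hk hnc (c (-1))
  obtain ⟨w, hw⟩ := hfield.exists_lift hk hL hγ.comp_sub_one (v₀ := deriv c (-1)) (S := T + 1)
    (by simp [hflow, h0]) (by linarith)
  have hmem : T + 1 ∈ Icc 1 (T + 1) := right_mem_Icc.2 (by linarith)
  have hle := hw.action_le _ hmem
  have hpos := hw.position_eq _ hmem
  have hext := (hfield.isExtremal (deriv c (-1))).action_le_of_contDiff hk hL hφ hnc
    (fun s => hfield.hasDerivAt_position s (w (T + 1)))
    (hfield.contDiff_velocity.continuous.comp (by fun_prop)) (T := T + 1) (by linarith)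
    (by simp [hφ.2.1]) (by simp [hpos, hflow, h1])
  rw [hfield.deriv_eq] at hext
  have hI : ∀ a b, IntervalIntegrable (fun s => L (φ s (c (-1), deriv c (-1)))) volume a b :=
    fun a b => ((hfield.contDiff_lagrangian h2).continuous.comp
      (f := fun s : ℝ => (s, deriv c (-1))) (by fun_prop)).intervalIntegrable a b
  have hsplit := intervalIntegral.integral_add_adjacent_intervals (hI 0 1) (hI 1 (T + 1))
  have hle' := (sub_le_iff_le_add'.2 (hext.trans hle))
  simp only [fieldAction, primitive, Prod.mk.eta, ← hsplit, add_sub_cancel_left] at hle'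
  simp only [hflow, ← sub_eq_add_neg] at hle'
  rw [intervalIntegral.integral_comp_sub_right (fun s => L (c s, deriv c s)) 1,
    intervalIntegral.integral_comp_sub_right (fun s => L (γ s, g s)) 1] at hle'
  simpa using hle'

end ExtremalsMinimize

section ActionCost

variable {n k : ℕ} {L : E n × E n → ℝ} {φ : ℝ → E n × E n → E n × E n} {c γ g : ℝ → E n}

lemma curveOf_indicator {x : E n} {T s : ℝ} (hs : s ∈ Icc 0 T) :
    curveOf n x ((Ioc 0 T).indicator g) s = curveOf n x g s := by
  simp only [curveOf, add_right_inj]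
  refine intervalIntegral.integral_congr_ae (ae_of_all _ fun u hu => ?_)
  rw [uIoc_of_le hs.1] at hu
  have hmem : u ∈ Ioc 0 T := ⟨hu.1, hu.2.trans hs.2⟩
  exact indicator_of_mem hmem g

/-- Extending a curve of finite action on `[0, T]` by constants. -/
lemma finiteActionCurve_indicator (hL : Continuous L) {x : E n} {T : ℝ} (hT : 0 ≤ T)
    (hg : IntervalIntegrable g volume 0 T)
    (hA : IntervalIntegrable (fun s => L (curveOf n x g s, g s)) volume 0 T) :
    FiniteActionCurve L (curveOf n x ((Ioc 0 T).indicator g)) ((Ioc 0 T).indicator g) := by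
  have hI : Integrable ((Ioc 0 T).indicator g) :=
    ((intervalIntegrable_iff_integrableOn_Ioc_of_le hT).1 hg).integrable_indicator
      measurableSet_Ioc
  have hi : ∀ a b, IntervalIntegrable ((Ioc 0 T).indicator g) volume a b :=
    fun a b => hI.intervalIntegrable
  have hcont : Continuous (curveOf n x ((Ioc 0 T).indicator g)) :=
    continuous_const.add (intervalIntegral.continuous_primitive hi 0)
  refine ⟨hi, fun s t => ?_, fun a b => ?_⟩
  · simp only [curveOf, add_sub_add_left_eq_sub]
    exact intervalIntegral.integral_interval_sub_left (hi _ _) (hi _ _)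
  · have h1 : Integrable ((Ioc 0 T).indicator fun s => L (curveOf n x g s, g s)) :=
      ((intervalIntegrable_iff_integrableOn_Ioc_of_le hT).1 hA).integrable_indicator
        measurableSet_Ioc
    have h2 : IntervalIntegrable
        ((Ioc 0 T)ᶜ.indicator fun s => L (curveOf n x ((Ioc 0 T).indicator g) s, 0))
        volume a b := by
      rw [intervalIntegrable_iff]
      exact (intervalIntegrable_iff.1 ((hL.comp
        (hcont.prodMk continuous_const)).intervalIntegrable a b)).indicator
          measurableSet_Ioc.compl
    refine (h1.intervalIntegrable.add h2).congr fun s _ => ?_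
    by_cases hs : s ∈ Ioc 0 T
    · simp [hs, curveOf_indicator (Ioc_subset_Icc_self hs)]
    · simp [hs]

/-- Without conjugate points, the action cost is the action of the connecting extremal. -/
lemma IsExtremal.Acost_eq (hk : 2 ≤ k) (hL : IsTonelliLagrangian n (k : ℕ∞) L)
    (hφ : IsELFlow n k L φ) (hnc : NoConjugatePoints n φ) (hc : IsExtremal n L c) {T : ℝ}
    (hT : 0 ≤ T) : Acost n L T (c 0) (c T) = ∫ s in (0 : ℝ)..T, L (c s, deriv c s) := by
  have hLc := (hL.contDiff_two hk).continuous
  have hcurve : curveOf n (c 0) (deriv c) = c := by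
    funext s
    rw [curveOf, intervalIntegral.integral_eq_sub_of_hasDerivAt (fun u _ => hc.hasDerivAt u)
      (hc.continuous_deriv.intervalIntegrable _ _), add_sub_cancel]
  refine IsLeast.csInf_eq ⟨⟨deriv c, hc.continuous_deriv.intervalIntegrable _ _, by rw [hcurve],
    ?_, by rw [hcurve]⟩, ?_⟩
  · rw [hcurve]
    exact (hLc.comp (hc.continuous.prodMk hc.continuous_deriv)).intervalIntegrable _ _
  · rintro A ⟨g, hg, hgT, hA, rfl⟩
    refine (hc.action_le hk hL hφ hnc (finiteActionCurve_indicator hLc hT hg hA) hT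
      (by simp [curveOf]) ((curveOf_indicator (right_mem_Icc.2 hT)).trans hgT)).trans_eq ?_
    refine intervalIntegral.integral_congr_ae (ae_of_all _ fun s hs => ?_)
    rw [uIoc_of_le hT] at hs
    rw [curveOf_indicator (Ioc_subset_Icc_self hs), indicator_of_mem hs]

end ActionCost

section Periodicity

variable {n k : ℕ} {L : E n × E n → ℝ} {φ : ℝ → E n × E n → E n × E n} {c : ℝ → E n}

/-- The endpoint condition `φ T (x, v) ∈ {x + a} × ℝⁿ` is locally solved continuously in `v`. -/
lemma IsELFlow.exists_velocity (hk : 2 ≤ k) (hφ : IsELFlow n k L φ)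
    (hnc : NoConjugatePoints n φ) {T : ℝ} (hT : T ≠ 0) {b v₀ a : E n}
    (h : (φ T (b, v₀)).1 = b + a) : ∃ v : E n → E n, Tendsto v (𝓝 b) (𝓝 v₀) ∧
      ∀ᶠ x in 𝓝 b, (φ T (x, v x)).1 = x + a := by
  let Φ : E n × E n → E n × E n := fun z => (z.1, (φ T z).1)
  have hφT : ContDiff ℝ 1 (φ T) :=
    (hφ.contDiff_one hk).comp (contDiff_const.prodMk contDiff_id)
  have hP : ContDiffAt ℝ 1 Φ (b, v₀) :=
    (contDiff_fst.prodMk (contDiff_fst.comp hφT)).contDiffAt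
  set F' : (E n × E n) →L[ℝ] (E n × E n) := (ContinuousLinearMap.fst ℝ (E n) (E n)).prod
    ((ContinuousLinearMap.fst ℝ (E n) (E n)).comp (fderiv ℝ (φ T) (b, v₀))) with hF'
  have hd : HasFDerivAt Φ F' (b, v₀) := hasFDerivAt_fst.prodMk
    (hasFDerivAt_fst.comp _ (hφT.differentiable (by norm_num) _).hasFDerivAt)
  have hinj : Function.Injective F' := by
    rw [injective_iff_map_eq_zero]
    rintro ⟨ξ, ω⟩ h0
    simp only [hF', ContinuousLinearMap.prod_apply, ContinuousLinearMap.comp_apply,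
      ContinuousLinearMap.coe_fst', Prod.mk_eq_zero] at h0
    obtain ⟨rfl, h0⟩ := h0
    rw [hnc _ T hT ω h0, Prod.mk_zero_zero]
  let A : (E n × E n) ≃L[ℝ] (E n × E n) :=
    (LinearEquiv.ofInjectiveEndo (F' : (E n × E n) →ₗ[ℝ] (E n × E n)) hinj).toContinuousLinearEquiv
  have hA : HasFDerivAt Φ (A : (E n × E n) →L[ℝ] (E n × E n)) (b, v₀) := by
    convert hd using 1
    exact ContinuousLinearMap.ext fun w => rfl
  let e := hP.toOpenPartialHomeomorph _ hA (by norm_num)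
  have he : ∀ z, e z = Φ z := fun z => rfl
  have hs : (b, v₀) ∈ e.source := hP.mem_toOpenPartialHomeomorph_source hA (by norm_num)
  have hb : e (b, v₀) = (b, b + a) := by rw [he]; exact Prod.ext rfl h
  have hgraph : Tendsto (fun x : E n => (x, x + a)) (𝓝 b) (𝓝 (e (b, v₀))) := by
    rw [hb]
    exact (Continuous.prodMk continuous_id (by fun_prop)).tendsto b
  refine ⟨fun x => (e.symm (x, x + a)).2, ?_, ?_⟩
  · have h1 := (e.tendsto_symm hs).comp hgraph
    exact (continuous_snd.tendsto _).comp h1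
  · filter_upwards [hgraph.eventually (e.open_target.mem_nhds (e.map_source hs))] with x hx
    have h1 : Φ (e.symm (x, x + a)) = (x, x + a) := by rw [← he, e.right_inv hx]
    obtain ⟨h2, h3⟩ := Prod.ext_iff.1 h1
    rwa [show (x, (e.symm (x, x + a)).2) = e.symm (x, x + a) from Prod.ext h2.symm rfl]

/-- The action along the flow lines translated in a fixed direction. -/
lemma hasStrictFDerivAt_translatedAction (hk : 2 ≤ k) (hL : ContDiff ℝ 2 L)
    (hφ : IsELFlow n k L φ) (T : ℝ) (z : E n × E n) (h : E n) :
    ∃ G' : (E n × E n) × ℝ →L[ℝ] ℝ,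
      HasStrictFDerivAt (fun q : (E n × E n) × ℝ =>
        ∫ s in (0 : ℝ)..T, L ((φ s q.1).1 + q.2 • h, (φ s q.1).2)) G' (z, 0) ∧
      G' (0, 1) = ∫ s in (0 : ℝ)..T, force L (φ s z) h := by
  have hφ1 := hφ.contDiff_one hk
  let f : ((E n × E n) × ℝ) × ℝ → ℝ :=
    fun p => L ((φ p.2 p.1.1).1 + p.1.2 • h, (φ p.2 p.1.1).2)
  have hφp : ContDiff ℝ 1 fun p : ((E n × E n) × ℝ) × ℝ => φ p.2 p.1.1 :=
    hφ1.comp (contDiff_snd.prodMk (contDiff_fst.comp contDiff_fst))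
  have hf : ContDiff ℝ 1 f := (hL.of_le (by norm_num)).comp
    (((contDiff_fst.comp hφp).add ((contDiff_snd.comp contDiff_fst).smul contDiff_const)).prodMk
      (contDiff_snd.comp hφp))
  refine ⟨_, ((contDiff_parametric_integral hf 0 T).contDiffAt.hasStrictFDerivAt'
    (hasFDerivAt_parametric_integral hf 0 T (z, 0)) (by norm_num)), ?_⟩
  have hc : Continuous fun s : ℝ => (fderiv ℝ f ((z, 0), s)).comp
      (ContinuousLinearMap.inl ℝ ((E n × E n) × ℝ) ℝ) :=
    ((hf.continuous_fderiv (by norm_num)).comp (by fun_prop)).clm_comp continuous_const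
  rw [ContinuousLinearMap.intervalIntegral_apply (hc.intervalIntegrable 0 T)]
  refine intervalIntegral.integral_congr fun s _ => ?_
  have h1 : HasDerivAt (fun θ : ℝ => f ((z, θ), s)) (fderiv ℝ f ((z, 0), s) ((0, 1), 0)) 0 :=
    (hf.differentiable (by norm_num) _).hasFDerivAt.comp_hasDerivAt (0 : ℝ)
      (((hasDerivAt_const _ z).prodMk (hasDerivAt_id (0 : ℝ))).prodMk (hasDerivAt_const _ s))
  have h2 : HasDerivAt (fun θ : ℝ => f ((z, θ), s)) (force L (φ s z) h) 0 := by
    have h3 := hasFDerivAt_position hL ((φ s z).1 + (0 : ℝ) • h) (φ s z).2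
    have h4 : HasDerivAt (fun θ : ℝ => (φ s z).1 + θ • h) h 0 := by
      simpa using ((hasDerivAt_id (0 : ℝ)).smul_const h).const_add (φ s z).1
    have h5 := h3.comp_hasDerivAt (0 : ℝ) h4
    rwa [zero_smul, add_zero] at h5
  exact h1.unique h2

/-- At a maximum of the action cost `x ↦ 𝒜_T(x, x + a)`, the first variation of the action under
translations of the connecting extremal is nonnegative. -/
lemma IsExtremal.integral_force_nonneg (hk : 2 ≤ k) (hL : IsTonelliLagrangian n (k : ℕ∞) L)
    (hφ : IsELFlow n k L φ) (hnc : NoConjugatePoints n φ) (hc : IsExtremal n L c) {T : ℝ}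
    (hT : 0 < T) {a : E n} (hcT : c T = c 0 + a)
    (hmax : ∀ x, Acost n L T x (x + a) ≤ Acost n L T (c 0) (c 0 + a)) (h : E n) :
    0 ≤ ∫ s in (0 : ℝ)..T, force L (c s, deriv c s) h := by
  have h2 := hL.contDiff_two hk
  have hflow : ∀ s, φ s (c 0, deriv c 0) = (c s, deriv c s) := fun s => by
    rw [hφ.apply_extremal hk hL hc, add_zero]
  obtain ⟨v, hv, hvT⟩ := hφ.exists_velocity hk hnc hT.ne' (b := c 0) (v₀ := deriv c 0) (a := a)
    (by rw [hflow, hcT])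
  obtain ⟨G', hG, hG'⟩ :=
    hasStrictFDerivAt_translatedAction hk h2 hφ T (c 0, deriv c 0) h
  set G : (E n × E n) × ℝ → ℝ := fun q =>
    ∫ s in (0 : ℝ)..T, L ((φ s q.1).1 + q.2 • h, (φ s q.1).2) with hGdef
  simp only [hflow] at hG'
  rw [← hG']
  by_contra! hneg
  let x : ℝ → E n := fun ε => c 0 - ε • h
  have hx : Tendsto x (𝓝[>] 0) (𝓝 (c 0)) := by
    have : Tendsto x (𝓝 0) (𝓝 (x 0)) := Continuous.tendsto (by fun_prop) 0
    simpa [x] using this.mono_left nhdsWithin_le_nhds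
  have hε : Tendsto (fun ε : ℝ => ε) (𝓝[>] 0) (𝓝 0) := nhdsWithin_le_nhds
  have hz : Tendsto (fun ε => (x ε, v (x ε))) (𝓝[>] 0) (𝓝 (c 0, deriv c 0)) :=
    hx.prodMk_nhds (hv.comp hx)
  have hlim := (hz.prodMk_nhds hε).prodMk_nhds (hz.prodMk_nhds (tendsto_const_nhds (x := (0 : ℝ))))
  have hlittle := hG.isLittleO.def (half_pos (neg_pos.2 hneg))
  obtain ⟨ε, ⟨hle, hend⟩, hpos⟩ := (((hlim.eventually hlittle).and
    (hx.eventually hvT)).and self_mem_nhdsWithin).exists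
  have hγ := (hφ.2.2 (x ε) (v (x ε))).1
  have hγd : deriv (fun s => (φ s (x ε, v (x ε))).1) = fun s => (φ s (x ε, v (x ε))).2 :=
    funext fun s => ((hφ.2.2 (x ε) (v (x ε))).2 s).symm
  have hcost : Acost n L T (x ε) (x ε + a) = G ((x ε, v (x ε)), 0) := by
    have := hγ.Acost_eq hk hL hφ hnc hT.le
    simp only [hγd, hend, hφ.2.1] at this
    simpa [hGdef] using this
  have hcost' : Acost n L T (c 0) (c 0 + a) ≤ G ((x ε, v (x ε)), ε) := by
    rw [← hcT, hc.Acost_eq hk hL hφ hnc hT.le]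
    refine hc.action_le_of_contDiff hk hL hφ hnc
      (γ := fun s => (φ s (x ε, v (x ε))).1 + ε • h) (fun s => ?_) ?_ hT.le ?_ ?_
    · have := hγ.hasDerivAt s
      rw [hγd] at this
      exact this.add_const _
    · rw [← hγd]
      exact hγ.continuous_deriv
    · simp [hφ.2.1, x]
    · simp only [hend, hcT, x]
      abel
  have hmono := (hmax (x ε)).trans hcost'
  rw [hcost] at hmono
  have hlin : G' (((x ε, v (x ε)), ε) - ((x ε, v (x ε)), 0)) = ε * G' (0, 1) := by
    rw [← smul_eq_mul, ← map_smul]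
    simp
  have hnorm : ‖((x ε, v (x ε)), ε) - ((x ε, v (x ε)), (0 : ℝ))‖ = ε := by
    simp [Prod.norm_def, abs_of_pos hpos, hpos.le]
  simp only [hlin, hnorm] at hle
  have := (le_abs_self _).trans hle
  nlinarith [mul_pos hpos (neg_pos.2 hneg)]

end Periodicity

/-- If `b` maximizes `f x = 𝒜_T(x, x + r)`, then the extremal curve `c`
with `c 0 = b`, `c T = b + r` satisfies `c (s + T) = c s + r` for all `s`, i.e. its
projection to `𝕋ⁿ` is a `T`-periodic extremal curve of homotopy class `r`. -/
theorem periodic_orbit_at_max (n k : ℕ) (hn : 1 ≤ n) (hk : 2 ≤ k)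
    (L : E n × E n → ℝ) (hL : IsTonelliLagrangian n (k : ℕ∞) L)
    (φ : ℝ → E n × E n → E n × E n) (hφ : IsELFlow n k L φ)
    (hnc : NoConjugatePoints n φ)
    (T : ℝ) (hT : 0 < T) (r : Fin n → ℤ) (b : E n)
    (hb : ∀ x : E n, Acost n L T x (x + intVec r) ≤ Acost n L T b (b + intVec r))
    (c : ℝ → E n) (hc : IsExtremal n L c) (hc0 : c 0 = b) (hcT : c T = b + intVec r) :
    ∀ s : ℝ, c (s + T) = c s + intVec r := by
  subst hc0
  have h2 := hL.contDiff_two hk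
  have hI : ∀ h : E n, ∫ s in (0 : ℝ)..T, force L (c s, deriv c s) h =
      momentum L (c T, deriv c T) h - momentum L (c 0, deriv c 0) h := fun h => by
    have hcont : Continuous fun s => force L (c s, deriv c s) :=
      (contDiff_force h2).continuous.comp (hc.continuous.prodMk hc.continuous_deriv)
    exact intervalIntegral.integral_eq_sub_of_hasDerivAt
      (f := fun s => momentum L (c s, deriv c s) h)
      (fun s _ => by simpa using (hc.hasDerivAt_momentum h2 s).clm_apply (hasDerivAt_const s h))
      ((hcont.clm_apply continuous_const).intervalIntegrable _ _)
  have hmom : momentum L (c 0, deriv c T) = momentum L (c 0, deriv c 0) := by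
    rw [← hL.momentum_periodic (c 0) (deriv c T) r, ← hcT]
    ext1 h
    have hp := hc.integral_force_nonneg hk hL hφ hnc hT hcT hb h
    have hm := hc.integral_force_nonneg hk hL hφ hnc hT hcT hb (-h)
    rw [hI] at hp hm
    simp only [map_neg] at hm
    linarith
  have hvel : deriv c T = deriv c 0 := momentum_injective h2 (hL.fiberConvex hk) hmom
  have heq : (fun t => c (t + T) - intVec r) = c := by
    refine ((hc.shift h2 T).sub_intVec hk hL r).unique h2 (hL.fiberConvex hk) hc (t := 0) ?_ ?_
    · simp [hcT]
    · rw [deriv_sub_const, deriv_comp_add_const, zero_add, hvel]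
  intro s
  rw [← sub_eq_iff_eq_add]
  exact congrFun heq s

end
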